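/- For every integer q ≥ 3, every r ∈ ℕ, every s ∈ ℕ and every collection Y_s ∈ 𝕐_s, there exists a function f ∈ Δ^(q)(Y_s) ∩ W^r such that limsup_{n→∞} n^r · E_n^(q)(f, Y_s) = ∞. -/

import Mathlib

noncomputable section

/-- A collection `Y_s ∈ 𝕐_s`: points `y 1 > y 2 > ⋯ > y (2s)` (decreasing in the index),
with the convention `y 0 = y (2s) + 2π`. -/
structure PtsColl (s : ℕ) where
  y : ℕ → ℝ
  lt : ∀ i : ℕ, 1 ≤ i → i ≤ 2 * s → y i < y (i - 1)
  per : y 0 = y (2 * s) + 2 * Real.pi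

/-- `f` is `q`-monotone (for `q ≥ 3`) on `[a,b]`: `f` is continuous on `[a,b]`,
`(q-2)`-times continuously differentiable on `(a,b)`, and `f^{(q-2)}` is convex on `(a,b)`. -/
def QMonotoneOn (q : ℕ) (f : ℝ → ℝ) (a b : ℝ) : Prop :=
  ContinuousOn f (Set.Icc a b) ∧
  ContDiffOn ℝ (q - 2 : ℕ) f (Set.Ioo a b) ∧
  ConvexOn ℝ (Set.Ioo a b) (iteratedDerivWithin (q - 2) f (Set.Ioo a b))

/-- `f ∈ Δ^(q)(Y_s)`: `f` is continuous, `2π`-periodic, and `(-1)^(i-1) f` is `q`-monotone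
on `[y i, y (i-1)]` for each `i = 1, …, 2s`. -/
def DeltaQ (q s : ℕ) (Y : PtsColl s) (f : ℝ → ℝ) : Prop :=
  Continuous f ∧ (∀ x : ℝ, f (x + 2 * Real.pi) = f x) ∧
  ∀ i : ℕ, 1 ≤ i → i ≤ 2 * s →
    QMonotoneOn q (fun x => (-1 : ℝ) ^ (i - 1) * f x) (Y.y i) (Y.y (i - 1))

/-- `T ∈ 𝒯_n`: a real trigonometric polynomial of degree at most `n`. -/
def IsTrigPoly (n : ℕ) (T : ℝ → ℝ) : Prop :=
  ∃ a b : ℕ → ℝ, ∀ t : ℝ,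
    T t = a 0 + ∑ k ∈ Finset.Icc 1 n, (a k * Real.cos (k * t) + b k * Real.sin (k * t))

/-- `f ∈ W^r`: `f` is `2π`-periodic, of class `C^{r-1}`, `f^{(r-1)}` is absolutely continuous
(being the integral of a locally integrable function `g = f^{(r)}`), and `esssup |f^{(r)}| ≤ 2`. -/
def SobolevW (r : ℕ) (f : ℝ → ℝ) : Prop :=
  (∀ x : ℝ, f (x + 2 * Real.pi) = f x) ∧
  ContDiff ℝ (r - 1 : ℕ) f ∧
  ∃ g : ℝ → ℝ,
    (∀ a b : ℝ, IntervalIntegrable g MeasureTheory.volume a b) ∧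
    (∀ᵐ x ∂MeasureTheory.volume, |g x| ≤ 2) ∧
    ∀ x : ℝ, iteratedDeriv (r - 1) f x =
      iteratedDeriv (r - 1) f 0 + ∫ t in (0 : ℝ)..x, g t

/-- `E_n^(q)(f, Y_s)`: the error of the best co-`q`-monotone approximation of `f`
by trigonometric polynomials of degree at most `n` belonging to `Δ^(q)(Y_s)`. -/
def ErrCoQ (q n s : ℕ) (Y : PtsColl s) (f : ℝ → ℝ) : ℝ :=
  sInf ((fun T => ⨆ x : ℝ, |f x - T x|) '' {T : ℝ → ℝ | IsTrigPoly n T ∧ DeltaQ q s Y T})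

open Polynomial in
/-- `h` is the real trigonometric polynomial `x ↦ e^{-iNx} p(e^{ix})`, of degree at most `N`. -/
def ExpRep (N : ℕ) (p : ℂ[X]) (h : ℝ → ℝ) : Prop :=
  p.natDegree ≤ 2 * N ∧
    ∀ x : ℝ, (h x : ℂ) * Complex.exp (N * (x * Complex.I)) = p.eval (Complex.exp (x * Complex.I))

namespace ExpRep

open Polynomial

variable {N N' : ℕ} {p p' : ℂ[X]} {h h' : ℝ → ℝ}

lemma norm_exp_mul_I (x : ℝ) : ‖Complex.exp (x * Complex.I)‖ = 1 :=
  Complex.norm_exp_ofReal_mul_I x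

lemma abs_le (hp : ExpRep N p h) {M : ℝ} (hM : ∀ k, ‖p.coeff k‖ ≤ M) (x : ℝ) :
    |h x| ≤ (2 * N + 1) * M := by
  have h1 : ‖(h x : ℂ) * Complex.exp (N * (x * Complex.I))‖ = |h x| := by
    rw [norm_mul, Complex.exp_nat_mul, norm_pow, norm_exp_mul_I]
    simp
  rw [← h1, hp.2 x, eval_eq_sum_range' (Nat.lt_succ_of_le hp.1)]
  refine (norm_sum_le _ _).trans ?_
  calc _ ≤ ∑ _i ∈ Finset.range (2 * N).succ, M := by
        refine Finset.sum_le_sum fun i _ => ?_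
        rw [norm_mul, norm_pow, norm_exp_mul_I]
        simpa using hM i
    _ = _ := by simp

lemma integral_exp_int (a : ℝ) {m : ℤ} (hm : m ≠ 0) :
    ∫ x in a..a + 2 * Real.pi, Complex.exp (m * Complex.I * x) = 0 := by
  have hc : (m : ℂ) * Complex.I ≠ 0 := by simp [hm]
  rw [integral_exp_mul_complex hc]
  have : (m : ℂ) * Complex.I * ((a + 2 * Real.pi : ℝ) : ℂ)
      = m * Complex.I * a + m * (2 * Real.pi * Complex.I) := by push_cast; ring
  rw [this, Complex.exp_add, Complex.exp_int_mul_two_pi_mul_I]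
  simp

lemma norm_coeff_le (hp : ExpRep N p h) (a : ℝ) (k : ℕ) :
    ‖p.coeff k‖ ≤ (1 / (2 * Real.pi)) * ∫ x in a..a + 2 * Real.pi, |h x| := by
  have hpi := Real.pi_pos
  have key : ∫ x in a..a + 2 * Real.pi,
      (h x : ℂ) * Complex.exp (((N : ℤ) - k : ℤ) * Complex.I * x) = 2 * Real.pi * p.coeff k := by
    have h1 : ∀ x : ℝ, (h x : ℂ) * Complex.exp (((N : ℤ) - k : ℤ) * Complex.I * x)
        = ∑ i ∈ Finset.range (2 * N + k).succ,
          p.coeff i * Complex.exp (((i : ℤ) - k : ℤ) * Complex.I * x) := by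
      intro x
      have e1 : Complex.exp (((N : ℤ) - k : ℤ) * Complex.I * x)
          = Complex.exp (N * (x * Complex.I)) * Complex.exp (-(k * (x * Complex.I))) := by
        rw [← Complex.exp_add]; congr 1; push_cast; ring
      rw [e1, ← mul_assoc, hp.2 x,
        eval_eq_sum_range' (n := (2 * N + k).succ) (by have := hp.1; omega), Finset.sum_mul]
      refine Finset.sum_congr rfl fun i _ => ?_
      rw [mul_assoc, ← Complex.exp_nat_mul, ← Complex.exp_add]
      congr 2; push_cast; ring
    simp_rw [h1]
    rw [intervalIntegral.integral_finsetSum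
      (fun i _ => (by fun_prop : Continuous _).intervalIntegrable _ _)]
    simp_rw [intervalIntegral.integral_const_mul]
    by_cases hk : k ∈ Finset.range (2 * N + k).succ
    · rw [Finset.sum_eq_single_of_mem k hk]
      · simp only [sub_self, Int.cast_zero, zero_mul, Complex.exp_zero,
          intervalIntegral.integral_const, add_sub_cancel_left, Complex.real_smul]
        push_cast; ring
      · intro i _ hik
        rw [integral_exp_int a (by omega), mul_zero]
    · exact absurd (Finset.mem_range.2 (by omega)) hk
  have h2 : ‖(2 * Real.pi * p.coeff k : ℂ)‖ ≤ ∫ x in a..a + 2 * Real.pi, |h x| := by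
    rw [← key]
    refine (intervalIntegral.norm_integral_le_integral_norm (by linarith)).trans (le_of_eq ?_)
    refine intervalIntegral.integral_congr fun x _ => ?_
    have : (((N : ℤ) - k : ℤ) : ℂ) * Complex.I * x = (((N : ℝ) - k) * x : ℝ) * Complex.I := by
      push_cast; ring
    simp only [norm_mul, this, norm_exp_mul_I]
    simp
  rw [norm_mul] at h2
  have h3 : ‖(2 * Real.pi : ℂ)‖ = 2 * Real.pi := by
    rw [norm_mul]; simp [abs_of_pos hpi]
  rw [h3] at h2
  rw [one_div, ← div_eq_inv_mul, le_div_iff₀ (by positivity)]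
  linarith

lemma mul (hp : ExpRep N p h) (hp' : ExpRep N' p' h') :
    ExpRep (N + N') (p * p') (fun x => h x * h' x) := by
  refine ⟨natDegree_mul_le.trans (by have := hp.1; have := hp'.1; omega), fun x => ?_⟩
  rw [eval_mul, ← hp.2, ← hp'.2]
  push_cast
  rw [add_mul, Complex.exp_add]
  ring

lemma deriv (hp : ExpRep N p h) (hh : Differentiable ℝ h) :
    ExpRep N (C Complex.I * (X * derivative p - C (N : ℂ) * p)) (deriv h) := by
  have hd := hp.1
  refine ⟨?_, fun x => ?_⟩
  · refine (natDegree_C_mul_le _ _).trans ((natDegree_sub_le _ _).trans (max_le ?_ ?_))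
    · by_cases h0 : p.natDegree = 0
      · rw [eq_C_of_natDegree_eq_zero h0]; simp
      · refine natDegree_mul_le.trans ?_
        have := natDegree_derivative_lt h0
        rw [natDegree_X]; omega
    · exact (natDegree_C_mul_le _ _).trans hd
  · have e0 : HasDerivAt (fun x : ℝ => (x : ℂ) * Complex.I) Complex.I x := by
      simpa using (Complex.ofRealCLM.hasDerivAt (x := x)).mul_const Complex.I
    have e4 : HasDerivAt (fun x : ℝ => (h x : ℂ)) ((_root_.deriv h x : ℝ) : ℂ) x :=
      (hh x).hasDerivAt.ofReal_comp
    have e5 : HasDerivAt (fun x : ℝ => Complex.exp (N * (x * Complex.I)))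
        (Complex.exp (N * (x * Complex.I)) * (N * Complex.I)) x := (e0.const_mul (N : ℂ)).cexp
    have e1 : HasDerivAt (fun x : ℝ => (h x : ℂ) * Complex.exp (N * (x * Complex.I)))
        (((_root_.deriv h x : ℝ) : ℂ) * Complex.exp (N * (x * Complex.I)) +
          h x * (Complex.exp (N * (x * Complex.I)) * (N * Complex.I))) x :=
      e4.mul e5
    have e2 : HasDerivAt (fun x : ℝ => p.eval (Complex.exp (x * Complex.I)))
        ((Complex.exp (x * Complex.I) * Complex.I) •
          (derivative p).eval (Complex.exp (x * Complex.I))) x :=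
      HasDerivAt.scomp (𝕜' := ℂ) (g₁ := fun z => p.eval z) x (p.hasDerivAt (Complex.exp (x * Complex.I))) e0.cexp
    have e3 := e1.unique (e2.congr_of_eventuallyEq (.of_forall hp.2))
    simp only [eval_mul, eval_C, eval_sub, eval_X]
    rw [← hp.2 x]
    rw [smul_eq_mul] at e3
    linear_combination e3

lemma coeff_deriv_le {M : ℝ} (hM : ∀ k, ‖p.coeff k‖ ≤ M) (hp : p.natDegree ≤ 2 * N) (k : ℕ) :
    ‖(C Complex.I * (X * derivative p - C (N : ℂ) * p)).coeff k‖ ≤ N * M := by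
  have hM0 : 0 ≤ M := (norm_nonneg _).trans (hM 0)
  have e : (X * derivative p).coeff k = k * p.coeff k := by
    cases k with
    | zero => simp
    | succ k => rw [coeff_X_mul, coeff_derivative]; push_cast; ring
  rw [coeff_C_mul, coeff_sub, coeff_C_mul, e, ← sub_mul, norm_mul, norm_mul, Complex.norm_I,
    one_mul]
  by_cases hk : k ≤ 2 * N
  · refine mul_le_mul ?_ (hM k) (norm_nonneg _) (by positivity)
    have : ((k : ℂ) - N) = (((k : ℝ) - N : ℝ) : ℂ) := by push_cast; ring
    rw [this, Complex.norm_real, Real.norm_eq_abs, _root_.abs_le]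
    have : (k : ℝ) ≤ 2 * N := by exact_mod_cast hk
    constructor <;> linarith [Nat.cast_nonneg (α := ℝ) k]
  · rw [coeff_eq_zero_of_natDegree_lt (by omega)]
    simp only [norm_zero, mul_zero]; positivity

lemma iteratedDeriv (hp : ExpRep N p h) (hh : ContDiff ℝ ⊤ h) {M : ℝ}
    (hM : ∀ k, ‖p.coeff k‖ ≤ M) (j : ℕ) :
    ∃ P, ExpRep N P (iteratedDeriv j h) ∧ ∀ k, ‖P.coeff k‖ ≤ N ^ j * M := by
  induction j with
  | zero => exact ⟨p, by simpa using hp, by simpa using hM⟩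
  | succ j ih =>
    obtain ⟨P, hP, hPM⟩ := ih
    refine ⟨_, by
      rw [iteratedDeriv_succ]
      exact hP.deriv (hh.differentiable_iteratedDeriv j (WithTop.coe_lt_top _)), fun k => ?_⟩
    rw [pow_succ', mul_assoc]
    exact coeff_deriv_le hPM hP.1 k

lemma cos_kernel (y : ℝ) (n : ℕ) :
    ∃ p, ExpRep n p (fun x => (Real.cos ((x - y) / 2) ^ 2) ^ n) := by
  refine ⟨(C (Complex.exp (-(y * Complex.I)) / 4) * X ^ 2 + C (1 / 2) * X
    + C (Complex.exp (y * Complex.I) / 4)) ^ n, ?_, fun x => ?_⟩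
  · refine natDegree_pow_le.trans ?_
    rw [mul_comm]
    exact Nat.mul_le_mul_right _ natDegree_quadratic_le
  · rw [eval_pow, Complex.exp_nat_mul, Complex.ofReal_pow, ← mul_pow]
    congr 1
    push_cast
    rw [Complex.cos]
    simp only [eval_add, eval_mul, eval_C, eval_pow, eval_X]
    have a1 : Complex.exp (-(y * Complex.I)) = (Complex.exp (y / 2 * Complex.I))⁻¹ ^ 2 := by
      rw [← Complex.exp_neg, ← Complex.exp_nat_mul]; congr 1; push_cast; ring
    have a2 : Complex.exp (y * Complex.I) = (Complex.exp (y / 2 * Complex.I)) ^ 2 := by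
      rw [← Complex.exp_nat_mul]; congr 1; push_cast; ring
    have a3 : Complex.exp (x * Complex.I) = (Complex.exp (x / 2 * Complex.I)) ^ 2 := by
      rw [← Complex.exp_nat_mul]; congr 1; push_cast; ring
    have a4 : Complex.exp ((x - y) / 2 * Complex.I)
        = Complex.exp (x / 2 * Complex.I) * (Complex.exp (y / 2 * Complex.I))⁻¹ := by
      rw [← Complex.exp_neg, ← Complex.exp_add]; congr 1; ring
    have a5 : Complex.exp (-((x - y) / 2) * Complex.I)
        = (Complex.exp (x / 2 * Complex.I))⁻¹ * Complex.exp (y / 2 * Complex.I) := by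
      rw [← Complex.exp_neg, ← Complex.exp_add]; congr 1; ring
    rw [a1, a2, a3, a4, a5]
    have hx := Complex.exp_ne_zero (x / 2 * Complex.I)
    have hy := Complex.exp_ne_zero (y / 2 * Complex.I)
    field_simp
    ring

end ExpRep

namespace IsTrigPoly

variable {n : ℕ} {T : ℝ → ℝ}

lemma contDiff (hT : IsTrigPoly n T) {m : WithTop ℕ∞} : ContDiff ℝ m T := by
  obtain ⟨a, b, h⟩ := hT
  rw [funext h]
  fun_prop

open Polynomial in
lemma exists_expRep (hT : IsTrigPoly n T) : ∃ p, ExpRep n p T := by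
  obtain ⟨a, b, h⟩ := hT
  refine ⟨C (a 0 : ℂ) * X ^ n + ∑ k ∈ Finset.Icc 1 n,
    (C ((a k - b k * Complex.I) / 2) * X ^ (n + k) + C ((a k + b k * Complex.I) / 2) * X ^ (n - k)),
    ?_, fun x => ?_⟩
  · refine natDegree_add_le_of_degree_le ((natDegree_C_mul_X_pow_le _ _).trans (by omega)) ?_
    refine natDegree_sum_le_of_forall_le _ _ fun k hk => ?_
    have := Finset.mem_Icc.1 hk
    exact natDegree_add_le_of_degree_le ((natDegree_C_mul_X_pow_le _ _).trans (by omega))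
      ((natDegree_C_mul_X_pow_le _ _).trans (by omega))
  · rw [h x]
    simp only [eval_add, eval_mul, eval_C, eval_pow, eval_X, eval_finsetSum]
    push_cast
    rw [add_mul, Finset.sum_mul, Complex.exp_nat_mul]
    congr 1
    refine Finset.sum_congr rfl fun k hk => ?_
    have hk' := Finset.mem_Icc.1 hk
    have hz := Complex.exp_ne_zero (x * Complex.I)
    have e1 : Complex.exp (k * x * Complex.I) = Complex.exp (x * Complex.I) ^ k := by
      rw [← Complex.exp_nat_mul]; congr 1; ring
    have e2 : Complex.exp (-(k * x) * Complex.I) = (Complex.exp (x * Complex.I) ^ k)⁻¹ := by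
      rw [← e1, ← Complex.exp_neg]; congr 1; ring
    rw [Complex.cos, Complex.sin, e1, e2, pow_sub₀ _ hz hk'.2, pow_add]
    set z := Complex.exp (x * Complex.I) ^ k
    set w := Complex.exp (x * Complex.I) ^ n
    ring

end IsTrigPoly

lemma ExpRep.integral_abs_le_moment {n : ℕ} (hn : 1 ≤ n) {p : Polynomial ℂ} {h : ℝ → ℝ}
    (hp : ExpRep (n + n) p h) (hh : Continuous h) (y : ℝ) :
    ∫ x in (y - Real.pi)..(y + Real.pi), |h x| ≤
      8 * n * ∫ x in (y - Real.pi)..(y + Real.pi), |h x| * |x - y| := by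
  have hpi := Real.pi_gt_three
  have hn' : (1 : ℝ) ≤ n := by exact_mod_cast hn
  set J := ∫ x in (y - Real.pi)..(y + Real.pi), |h x| with hJ
  have hJ0 : 0 ≤ J := intervalIntegral.integral_nonneg (by linarith) fun x _ => abs_nonneg _
  have hsup : ∀ x, |h x| ≤ (2 * (n + n : ℕ) + 1) * ((1 / (2 * Real.pi)) * J) := by
    refine fun x => hp.abs_le (fun k => ?_) x
    have := hp.norm_coeff_le (y - Real.pi) k
    rwa [show y - Real.pi + 2 * Real.pi = y + Real.pi by ring] at this
  have hsup' : ∀ x, |h x| ≤ n * J := by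
    intro x
    refine (hsup x).trans ?_
    push_cast
    rw [← mul_assoc]
    refine mul_le_mul_of_nonneg_right ?_ hJ0
    rw [mul_one_div, div_le_iff₀ (by positivity)]
    nlinarith
  set δ : ℝ := 1 / (4 * n) with hδ
  have hδ0 : 0 < δ := by positivity
  have hδπ : δ < Real.pi := by
    have : δ ≤ 1 := by rw [hδ, div_le_one (by positivity)]; linarith
    linarith
  have hnδ : n * δ = 1 / 4 := by rw [hδ]; field_simp
  have hi : ∀ a b, IntervalIntegrable (fun x => |h x|) MeasureTheory.volume a b :=
    fun a b => (by fun_prop : Continuous fun x => |h x|).intervalIntegrable a b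
  have hi' : ∀ a b, IntervalIntegrable (fun x => |h x| * |x - y|) MeasureTheory.volume a b :=
    fun a b => (by fun_prop : Continuous fun x => |h x| * |x - y|).intervalIntegrable a b
  have split : ∀ f : ℝ → ℝ, (∀ a b, IntervalIntegrable f MeasureTheory.volume a b) →
      ∫ x in (y - Real.pi)..(y + Real.pi), f x = (∫ x in (y - Real.pi)..(y - δ), f x)
        + (∫ x in (y - δ)..(y + δ), f x) + ∫ x in (y + δ)..(y + Real.pi), f x := by
    intro f hf
    rw [intervalIntegral.integral_add_adjacent_intervals (hf _ _) (hf _ _),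
      intervalIntegral.integral_add_adjacent_intervals (hf _ _) (hf _ _)]
  have mid : ∫ x in (y - δ)..(y + δ), |h x| ≤ J / 2 := by
    have : ∫ x in (y - δ)..(y + δ), |h x| ≤ ∫ x in (y - δ)..(y + δ), n * J :=
      intervalIntegral.integral_mono_on (by linarith) (hi _ _) (by simp) fun x _ => hsup' x
    rw [intervalIntegral.integral_const, smul_eq_mul] at this
    nlinarith
  have mid' : 0 ≤ ∫ x in (y - δ)..(y + δ), |h x| * |x - y| :=
    intervalIntegral.integral_nonneg (by linarith) fun x _ => by positivity
  have pt : ∀ x, δ ≤ |x - y| → |h x| ≤ 4 * n * (|h x| * |x - y|) := by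
    intro x hx
    have : 1 ≤ 4 * n * |x - y| := by nlinarith
    nlinarith [abs_nonneg (h x)]
  have left : ∫ x in (y - Real.pi)..(y - δ), |h x| ≤
      4 * n * ∫ x in (y - Real.pi)..(y - δ), |h x| * |x - y| := by
    rw [← intervalIntegral.integral_const_mul]
    refine intervalIntegral.integral_mono_on (by linarith) (hi _ _) ((hi' _ _).const_mul _) ?_
    intro x hx
    exact pt x (by rw [abs_sub_comm]; exact le_abs.2 (.inl (by linarith [hx.2])))
  have right : ∫ x in (y + δ)..(y + Real.pi), |h x| ≤
      4 * n * ∫ x in (y + δ)..(y + Real.pi), |h x| * |x - y| := by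
    rw [← intervalIntegral.integral_const_mul]
    refine intervalIntegral.integral_mono_on (by linarith) (hi _ _) ((hi' _ _).const_mul _) ?_
    intro x hx
    exact pt x (le_abs.2 (.inl (by linarith [hx.1])))
  have s1 := split _ hi
  have s2 := split _ hi'
  rw [← hJ] at s1
  rw [s2]
  nlinarith

lemma one_le_cos_kernel_add (n : ℕ) (t : ℝ) : 1 ≤ (Real.cos (t / 2) ^ 2) ^ n + n * |t| := by
  have h1 := one_add_mul_le_pow (a := -Real.sin (t / 2) ^ 2)
    (by nlinarith [Real.sin_sq_le_one (t / 2)]) n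
  have h2 : Real.sin (t / 2) ^ 2 ≤ |t| := by
    have := Real.abs_sin_le_one (t / 2)
    have h3 : |Real.sin (t / 2)| ≤ |t / 2| := Real.abs_sin_le_abs
    rw [abs_div, abs_two] at h3
    rw [← sq_abs]
    nlinarith [abs_nonneg (Real.sin (t / 2)), abs_nonneg t]
  rw [Real.cos_sq', sub_eq_add_neg]
  nlinarith [Nat.cast_nonneg (α := ℝ) n]

/-- Structure of a cut-off function around `y` at scale `ρ`. -/
structure IsCutoff (y ρ : ℝ) (χ : ℝ → ℝ) : Prop where
  contDiff : ∀ m : ℕ, ContDiff ℝ m χ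
  nonneg : ∀ x, 0 ≤ χ x
  le_one : ∀ x, χ x ≤ 1
  eq_one : ∀ x, |x - y| ≤ ρ / 2 → χ x = 1
  eq_zero : ∀ x, ρ ≤ |x - y| → χ x = 0

lemma exists_isCutoff (y : ℝ) {ρ : ℝ} (hρ : 0 < ρ) : ∃ χ, IsCutoff y ρ χ := by
  let f : ContDiffBump y := ⟨ρ / 2, ρ, by linarith, by linarith⟩
  exact ⟨f, fun m => f.contDiff, fun x => f.nonneg, fun x => f.le_one,
    fun x hx => f.one_of_mem_closedBall (by rwa [Metric.mem_closedBall, Real.dist_eq]),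
    fun x hx => f.zero_of_le_dist (by rwa [Real.dist_eq])⟩

lemma IsTrigPoly.local_mass_le {n q : ℕ} {T : ℝ → ℝ} (hT : IsTrigPoly n T) (hn : 1 ≤ n)
    {y ρ B : ℝ} (hρ : 0 < ρ) (hρπ : ρ < Real.pi) {χ : ℝ → ℝ} (hχ : IsCutoff y ρ χ)
    (hs : ∀ x, |x - y| < ρ → 0 ≤ iteratedDeriv q T x * (x - y)) (hB : ∀ x, |T x| ≤ B) :
    ∫ x in (y - Real.pi)..(y + Real.pi), iteratedDeriv q T x * χ x ≤
      160 * n * ((∫ x in (y - Real.pi)..(y + Real.pi), iteratedDeriv q T x * ((x - y) * χ x)) +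
        (Real.cos (ρ / 4) ^ 2) ^ n * ((2 * n + 1) * (n ^ q * B))) := by
  have hpi := Real.pi_gt_three
  have hpi4 := Real.pi_le_four
  have hn' : (1 : ℝ) ≤ n := by exact_mod_cast hn
  have hcχ : Continuous χ := (hχ.contDiff 0).continuous
  obtain ⟨p, hp⟩ := hT.exists_expRep
  have hTc : Continuous T := (hT.contDiff (m := 0)).continuous
  have hpB : ∀ k, ‖p.coeff k‖ ≤ B := by
    intro k
    refine (hp.norm_coeff_le 0 k).trans ?_
    have : ∫ x in (0 : ℝ)..0 + 2 * Real.pi, |T x| ≤ ∫ x in (0 : ℝ)..0 + 2 * Real.pi, B :=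
      intervalIntegral.integral_mono_on (by linarith)
        ((by fun_prop : Continuous fun x => |T x|).intervalIntegrable _ _) (by simp) fun x _ => hB x
    rw [intervalIntegral.integral_const, smul_eq_mul] at this
    rw [one_div, ← div_eq_inv_mul, div_le_iff₀ (by positivity)]
    linarith
  obtain ⟨P, hP, hPB⟩ := hp.iteratedDeriv hT.contDiff hpB q
  set D := iteratedDeriv q T with hD
  have hDc : Continuous D := (hT.contDiff (m := q)).continuous_iteratedDeriv q le_rfl
  set S : ℝ := (2 * n + 1) * (n ^ q * B) with hS
  have hDS : ∀ x, |D x| ≤ S := fun x => hP.abs_le hPB x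
  have hS0 : 0 ≤ S := (abs_nonneg _).trans (hDS 0)
  obtain ⟨pQ, hQ⟩ := ExpRep.cos_kernel y n
  set Q : ℝ → ℝ := fun x => (Real.cos ((x - y) / 2) ^ 2) ^ n with hQdef
  have hQc : Continuous Q := by fun_prop
  have hQ0 : ∀ x, 0 ≤ Q x := fun x => by positivity
  have hQ1 : ∀ x, Q x ≤ 1 := fun x => pow_le_one₀ (by positivity) (Real.cos_sq_le_one _)
  set κ : ℝ := (Real.cos (ρ / 4) ^ 2) ^ n with hκ
  have hκ0 : 0 ≤ κ := by positivity
  have hQκ : ∀ x, ρ / 2 ≤ |x - y| → |x - y| ≤ Real.pi → Q x ≤ κ := by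
    intro x h1 h2
    refine pow_le_pow_left₀ (by positivity) ?_ n
    rw [← Real.cos_abs ((x - y) / 2), abs_div, abs_two]
    refine pow_le_pow_left₀ (Real.cos_nonneg_of_neg_pi_div_two_le_of_le (by linarith)
      (by linarith)) ?_ 2
    exact Real.cos_le_cos_of_nonneg_of_le_pi (by linarith) (by linarith) (by linarith)
  have hnn : ∀ x, 0 ≤ D x * ((x - y) * χ x) := by
    intro x
    rw [← mul_assoc]
    rcases lt_or_ge |x - y| ρ with h | h
    · exact mul_nonneg (hs x h) (hχ.nonneg x)
    · rw [hχ.eq_zero x h, mul_zero]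
  have habs : ∀ x, D x * ((x - y) * χ x) = |D x| * |x - y| * χ x := by
    intro x
    rw [← abs_of_nonneg (hnn x), abs_mul, abs_mul, abs_of_nonneg (hχ.nonneg x), mul_assoc]
  have m1 := (hP.mul hQ).integral_abs_le_moment hn (by fun_prop) y
  have m2 : ∫ x in (y - Real.pi)..(y + Real.pi), |D x * Q x| * |x - y| ≤
      ∫ x in (y - Real.pi)..(y + Real.pi), (D x * ((x - y) * χ x) + κ * S * Real.pi) := by
    refine intervalIntegral.integral_mono_on (by linarith)
      ((by fun_prop : Continuous _).intervalIntegrable _ _)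
      ((by fun_prop : Continuous _).intervalIntegrable _ _) fun x hx => ?_
    have hxπ : |x - y| ≤ Real.pi := abs_le.2 ⟨by linarith [hx.1], by linarith [hx.2]⟩
    rw [abs_mul, abs_of_nonneg (hQ0 x)]
    rcases le_or_gt |x - y| (ρ / 2) with h | h
    · rw [habs, hχ.eq_one x h, mul_one]
      have : |D x| * Q x * |x - y| ≤ |D x| * 1 * |x - y| := by gcongr; exact hQ1 x
      have : 0 ≤ κ * S * Real.pi := by positivity
      linarith
    · have : |D x| * Q x * |x - y| ≤ S * κ * Real.pi := by
        gcongr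
        · exact hDS x
        · exact hQκ x h.le hxπ
      linarith [hnn x]
  rw [intervalIntegral.integral_add ((by fun_prop : Continuous _).intervalIntegrable _ _)
    (by simp), intervalIntegral.integral_const, smul_eq_mul] at m2
  have m3 : ∫ x in (y - Real.pi)..(y + Real.pi), D x * χ x ≤
      ∫ x in (y - Real.pi)..(y + Real.pi), (|D x * Q x| + n * (D x * ((x - y) * χ x))) := by
    refine intervalIntegral.integral_mono_on (by linarith)
      ((by fun_prop : Continuous _).intervalIntegrable _ _)
      ((by fun_prop : Continuous _).intervalIntegrable _ _) fun x _ => ?_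
    rw [habs, abs_mul, abs_of_nonneg (hQ0 x)]
    have h1 : 1 ≤ Q x + n * |x - y| := one_le_cos_kernel_add n (x - y)
    have h2 := hχ.nonneg x
    have h3 := hχ.le_one x
    calc D x * χ x ≤ |D x| * χ x := by gcongr; exact le_abs_self _
      _ ≤ |D x| * χ x * (Q x + n * |x - y|) := le_mul_of_one_le_right (by positivity) h1
      _ = |D x| * Q x * χ x + n * (|D x| * |x - y| * χ x) := by ring
      _ ≤ |D x| * Q x * 1 + n * (|D x| * |x - y| * χ x) := by
        gcongr
      _ = _ := by ring
  rw [intervalIntegral.integral_add ((by fun_prop : Continuous _).intervalIntegrable _ _)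
    ((by fun_prop : Continuous _).intervalIntegrable _ _),
    intervalIntegral.integral_const_mul] at m3
  set X := ∫ x in (y - Real.pi)..(y + Real.pi), D x * ((x - y) * χ x) with hX
  have hX0 : 0 ≤ X := intervalIntegral.integral_nonneg (by linarith) fun x _ => hnn x
  have h20 : (y + Real.pi - (y - Real.pi)) * (κ * S * Real.pi) ≤ 19.9 * (κ * S) := by
    have h314 := Real.pi_lt_d2
    have : (y + Real.pi - (y - Real.pi)) * (κ * S * Real.pi)
      = (2 * Real.pi * Real.pi) * (κ * S) := by ring
    rw [this]
    refine mul_le_mul_of_nonneg_right ?_ (by positivity)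
    nlinarith
  have hκS : 0 ≤ κ * S := by positivity
  nlinarith [mul_nonneg (by linarith : (0 : ℝ) ≤ n) hX0, mul_nonneg (by linarith : (0 : ℝ) ≤ n) hκS]

/-- A smooth function supported in a ball of radius less than `π` around `y`. -/
structure IsTest (y : ℝ) (φ : ℝ → ℝ) : Prop where
  contDiff : ∀ m : ℕ, ContDiff ℝ m φ
  support : ∃ ρ < Real.pi, ∀ x, ρ ≤ |x - y| → φ x = 0

namespace IsTest

variable {y : ℝ} {φ : ℝ → ℝ}

lemma differentiable (hφ : IsTest y φ) : Differentiable ℝ φ :=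
  (hφ.contDiff 1).differentiable (by simp)

lemma deriv (hφ : IsTest y φ) : IsTest y (deriv φ) := by
  refine ⟨fun m => ?_, ?_⟩
  · exact (contDiff_succ_iff_deriv.1 (by exact_mod_cast hφ.contDiff (m + 1))).2.2
  · obtain ⟨ρ, hρ, h⟩ := hφ.support
    refine ⟨(ρ + Real.pi) / 2, by linarith, fun x hx => ?_⟩
    have : φ =ᶠ[nhds x] fun _ => 0 := by
      have ho : IsOpen {z : ℝ | ρ < |z - y|} := isOpen_lt (by fun_prop) (by fun_prop)
      filter_upwards [ho.mem_nhds (show ρ < |x - y| by linarith)] with z hz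
      exact h z (le_of_lt hz)
    rw [this.deriv_eq]; simp

lemma eq_zero_left (hφ : IsTest y φ) : φ (y - Real.pi) = 0 := by
  obtain ⟨ρ, hρ, h⟩ := hφ.support
  exact h _ (by simp [abs_of_pos Real.pi_pos, hρ.le])

lemma eq_zero_right (hφ : IsTest y φ) : φ (y + Real.pi) = 0 := by
  obtain ⟨ρ, hρ, h⟩ := hφ.support
  exact h _ (by simp [abs_of_pos Real.pi_pos, hρ.le])

lemma integral_iteratedDeriv_mul {f : ℝ → ℝ} {m : ℕ} (hf : ContDiff ℝ m f) (hφ : IsTest y φ) :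
    ∫ x in (y - Real.pi)..(y + Real.pi), iteratedDeriv m f x * φ x =
      (-1) ^ m * ∫ x in (y - Real.pi)..(y + Real.pi), f x * iteratedDeriv m φ x := by
  induction m generalizing φ with
  | zero => simp
  | succ m ih =>
    have hd : Differentiable ℝ (iteratedDeriv m f) :=
      hf.differentiable_iteratedDeriv m (by exact_mod_cast Nat.lt_succ_self m)
    have h1 := intervalIntegral.integral_mul_deriv_eq_deriv_mul
      (a := y - Real.pi) (b := y + Real.pi) (u := iteratedDeriv m f) (v := φ)
      (fun x _ => (hd x).hasDerivAt) (fun x _ => (hφ.differentiable x).hasDerivAt)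
      (by
        rw [← iteratedDeriv_succ]
        exact (hf.continuous_iteratedDeriv (m + 1) le_rfl).intervalIntegrable _ _)
      ((hφ.deriv.contDiff 0).continuous.intervalIntegrable _ _)
    rw [hφ.eq_zero_left, hφ.eq_zero_right] at h1
    rw [iteratedDeriv_succ, iteratedDeriv_succ']
    have h2 := ih (hf.of_le (by exact_mod_cast Nat.le_succ m)) hφ.deriv
    rw [h1] at h2
    rw [pow_succ, mul_assoc, mul_comm ((-1) ^ m)] at *
    linarith

lemma _root_.IsCutoff.isTest {ρ : ℝ} {χ : ℝ → ℝ} (hχ : IsCutoff y ρ χ) (hρ : ρ < Real.pi) :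
    IsTest y χ :=
  ⟨hχ.contDiff, ρ, hρ, hχ.eq_zero⟩

lemma _root_.IsCutoff.isTest_mul {ρ : ℝ} {χ : ℝ → ℝ} (hχ : IsCutoff y ρ χ) (hρ : ρ < Real.pi) :
    IsTest y (fun x => (x - y) * χ x) :=
  ⟨fun m => by have := hχ.contDiff m; fun_prop, ρ, hρ, fun x hx => by simp [hχ.eq_zero x hx]⟩

end IsTest

/-- A locally integrable `2π`-periodic function with mean value zero. -/
structure PerZero (S : ℝ → ℝ) : Prop where
  periodic : Function.Periodic S (2 * Real.pi)
  integrable : ∀ a b, IntervalIntegrable S MeasureTheory.volume a b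
  mean : ∫ x in (0 : ℝ)..(2 * Real.pi), S x = 0

/-- The primitive of `S` whose mean value over `[0, 2π]` is zero. -/
def perInt (S : ℝ → ℝ) (x : ℝ) : ℝ :=
  (∫ t in (0 : ℝ)..x, S t) - (1 / (2 * Real.pi)) * ∫ u in (0 : ℝ)..(2 * Real.pi), ∫ t in (0 : ℝ)..u, S t

namespace PerZero

variable {S S' : ℝ → ℝ}

lemma continuous_perInt (hS : PerZero S) : Continuous (perInt S) :=
  (intervalIntegral.continuous_primitive hS.integrable 0).sub continuous_const

lemma perInt (hS : PerZero S) : PerZero (perInt S) := by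
  have hc := hS.continuous_perInt
  refine ⟨fun x => ?_, fun a b => hc.intervalIntegrable a b, ?_⟩
  · unfold _root_.perInt
    rw [← intervalIntegral.integral_add_adjacent_intervals (hS.integrable 0 x)
      (hS.integrable x (x + 2 * Real.pi)), hS.periodic.intervalIntegral_add_eq x 0, zero_add,
      hS.mean, add_zero]
  · unfold _root_.perInt
    rw [intervalIntegral.integral_sub
      ((intervalIntegral.continuous_primitive hS.integrable 0).intervalIntegrable _ _) (by simp),
      intervalIntegral.integral_const, smul_eq_mul]
    have := Real.pi_pos
    field_simp
    ring

lemma iterate_perInt (hS : PerZero S) (m : ℕ) : PerZero (_root_.perInt^[m] S) := by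
  induction m with
  | zero => exact hS
  | succ m ih => rw [Function.iterate_succ_apply']; exact ih.perInt

lemma hasDerivAt_perInt (hS : PerZero S) {x : ℝ} (hx : ContinuousAt S x) :
    HasDerivAt (_root_.perInt S) (S x) x := by
  refine HasDerivAt.sub_const _ ?_
  refine intervalIntegral.integral_hasDerivAt_right (hS.integrable 0 x) ?_ hx
  refine ⟨Set.Ioc (x - 1) (x + 1), Ioc_mem_nhds (by linarith) (by linarith), ?_⟩
  exact (hS.integrable (x - 1) (x + 1)).1.aestronglyMeasurable

lemma perInt_deriv {u : ℝ → ℝ} (hu : PerZero u) (hd : ContDiff ℝ 1 u) :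
    _root_.perInt (deriv u) = u := by
  have hc : Continuous (deriv u) := hd.continuous_deriv le_rfl
  have h1 : ∀ x, ∫ t in (0 : ℝ)..x, deriv u t = u x - u 0 := fun x =>
    intervalIntegral.integral_deriv_eq_sub (fun t _ => hd.differentiable (by simp) t)
      (hc.intervalIntegrable _ _)
  funext x
  unfold _root_.perInt
  simp_rw [h1]
  rw [intervalIntegral.integral_sub (hu.integrable _ _) (by simp), hu.mean]
  have := Real.pi_pos
  simp
  field_simp
  ring

lemma deriv {u : ℝ → ℝ} (hu : PerZero u) (hd : ContDiff ℝ 1 u) : PerZero (deriv u) := by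
  have hc : Continuous (_root_.deriv u) := hd.continuous_deriv le_rfl
  refine ⟨fun x => ?_, fun a b => hc.intervalIntegrable a b, ?_⟩
  · have h := deriv_comp_add_const u (2 * Real.pi) x
    rw [← h]
    exact congrArg (fun g => _root_.deriv g x) (funext hu.periodic)
  · rw [intervalIntegral.integral_deriv_eq_sub (fun t _ => hd.differentiable (by simp) t)
      (hc.intervalIntegrable _ _), sub_eq_zero]
    simpa using hu.periodic 0

lemma iteratedDeriv {u : ℝ → ℝ} (hu : PerZero u) (m : ℕ) (hd : ContDiff ℝ m u) :
    PerZero (iteratedDeriv m u) ∧ _root_.perInt^[m] (iteratedDeriv m u) = u := by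
  induction m generalizing u with
  | zero => exact ⟨by simpa using hu, by simp⟩
  | succ m ih =>
    have hd' := contDiff_succ_iff_deriv.1 (by exact_mod_cast hd : ContDiff ℝ ((m : WithTop ℕ∞) + 1) u)
    have h1 : ContDiff ℝ 1 u := hd.of_le (by exact_mod_cast Nat.le_add_left 1 m)
    have h2 := ih (hu.deriv h1) hd'.2.2
    rw [iteratedDeriv_succ', Function.iterate_succ_apply', h2.2]
    exact ⟨h2.1, hu.perInt_deriv h1⟩

lemma abs_perInt_le (hS : PerZero S) {B : ℝ} (hB : ∀ x, |S x| ≤ B) (x : ℝ) :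
    |_root_.perInt S x| ≤ 16 * B := by
  have hpi := Real.pi_pos
  have hpi4 := Real.pi_le_four
  have hB0 : 0 ≤ B := (abs_nonneg _).trans (hB 0)
  obtain ⟨z, hz, hxz⟩ := hS.perInt.periodic.exists_mem_Ico₀ (by positivity) x
  have h1 : ∀ w ∈ Set.Icc 0 (2 * Real.pi), |∫ t in (0 : ℝ)..w, S t| ≤ 2 * Real.pi * B := by
    intro w hw
    have := intervalIntegral.norm_integral_le_of_norm_le_const (a := 0) (b := w) (f := S)
      (C := B) fun t _ => hB t
    rw [sub_zero, abs_of_nonneg hw.1, Real.norm_eq_abs] at this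
    nlinarith [hw.2]
  have h2 : |∫ u in (0 : ℝ)..(2 * Real.pi), ∫ t in (0 : ℝ)..u, S t|
      ≤ 2 * Real.pi * B * (2 * Real.pi) := by
    have := intervalIntegral.norm_integral_le_of_norm_le_const (a := 0) (b := 2 * Real.pi)
      (f := fun u => ∫ t in (0 : ℝ)..u, S t) (C := 2 * Real.pi * B) fun t ht => by
        rw [Set.uIoc_of_le (by positivity)] at ht
        exact h1 t ⟨ht.1.le, ht.2⟩
    rwa [sub_zero, abs_of_pos (by positivity : (0 : ℝ) < 2 * Real.pi), Real.norm_eq_abs] at this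
  rw [hxz]
  unfold _root_.perInt
  refine (abs_sub _ _).trans ?_
  have h3 := h1 z ⟨hz.1, hz.2.le⟩
  rw [abs_mul, abs_of_pos (by positivity : (0 : ℝ) < 1 / (2 * Real.pi))]
  have h4 : 1 / (2 * Real.pi) * |∫ u in (0 : ℝ)..(2 * Real.pi), ∫ t in (0 : ℝ)..u, S t|
      ≤ 2 * Real.pi * B := by
    rw [one_div, ← div_eq_inv_mul, div_le_iff₀ (by positivity)]
    exact h2
  nlinarith

lemma abs_iterate_perInt_le (hS : PerZero S) {B : ℝ} (hB : ∀ x, |S x| ≤ B) (m : ℕ) (x : ℝ) :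
    |_root_.perInt^[m] S x| ≤ 16 ^ m * B := by
  induction m generalizing x with
  | zero => simpa using hB x
  | succ m ih =>
    rw [Function.iterate_succ_apply', pow_succ', mul_assoc]
    exact (hS.iterate_perInt m).abs_perInt_le ih x

lemma sub (hS : PerZero S) (hS' : PerZero S') : PerZero (fun x => S x - S' x) :=
  ⟨fun x => by simp only [hS.periodic x, hS'.periodic x],
    fun a b => (hS.integrable a b).sub (hS'.integrable a b), by
      rw [intervalIntegral.integral_sub (hS.integrable _ _) (hS'.integrable _ _), hS.mean, hS'.mean,
        sub_zero]⟩

lemma perInt_sub (hS : PerZero S) (hS' : PerZero S') :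
    _root_.perInt (fun x => S x - S' x) = fun x => _root_.perInt S x - _root_.perInt S' x := by
  funext x
  unfold _root_.perInt
  simp_rw [fun u => intervalIntegral.integral_sub (hS.integrable 0 u) (hS'.integrable 0 u)]
  rw [intervalIntegral.integral_sub
    ((intervalIntegral.continuous_primitive hS.integrable 0).intervalIntegrable _ _)
    ((intervalIntegral.continuous_primitive hS'.integrable 0).intervalIntegrable _ _)]
  ring

lemma iterate_perInt_sub (hS : PerZero S) (hS' : PerZero S') (m : ℕ) :
    _root_.perInt^[m] (fun x => S x - S' x) =
      fun x => _root_.perInt^[m] S x - _root_.perInt^[m] S' x := by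
  induction m with
  | zero => rfl
  | succ m ih =>
    simp only [Function.iterate_succ_apply', ih]
    exact (hS.iterate_perInt m).perInt_sub (hS'.iterate_perInt m)

lemma contDiffOn_iterate_perInt (hS : PerZero S) {O : Set ℝ} (hO : IsOpen O)
    (hc : ContinuousOn S O) (m : ℕ) :
    ContDiffOn ℝ m (_root_.perInt^[m] S) O ∧
      Set.EqOn (iteratedDerivWithin m (_root_.perInt^[m] S) O) S O := by
  induction m with
  | zero => exact ⟨by simpa using hc, fun x _ => by simp⟩
  | succ m ih =>
    rw [Function.iterate_succ_apply']
    have hd : ∀ x ∈ O, HasDerivAt (_root_.perInt (_root_.perInt^[m] S)) (_root_.perInt^[m] S x) x :=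
      fun x hx => (hS.iterate_perInt m).hasDerivAt_perInt
        (ih.1.continuousOn.continuousAt (hO.mem_nhds hx))
    constructor
    · push_cast
      rw [contDiffOn_succ_iff_deriv_of_isOpen hO]
      refine ⟨fun x hx => (hd x hx).differentiableAt.differentiableWithinAt, by simp, ?_⟩
      exact ih.1.congr fun x hx => (hd x hx).deriv
    · intro x hx
      rw [iteratedDerivWithin_succ']
      rw [← ih.2 hx]
      refine iteratedDerivWithin_congr (fun z hz => ?_) hx
      rw [derivWithin_of_isOpen hO hz, (hd z hz).deriv]

lemma contDiff_iterate_perInt (hS : PerZero S) (hc : Continuous S) (m : ℕ) :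
    ContDiff ℝ m (_root_.perInt^[m] S) ∧ _root_.iteratedDeriv m (_root_.perInt^[m] S) = S := by
  have h := hS.contDiffOn_iterate_perInt isOpen_univ hc.continuousOn m
  refine ⟨contDiffOn_univ.1 h.1, funext fun x => ?_⟩
  rw [← iteratedDerivWithin_univ]
  exact h.2 (Set.mem_univ x)

lemma sobolevW {G : ℝ → ℝ} (hG : PerZero G) (hG2 : ∀ x, |G x| ≤ 2) {r : ℕ} (hr : 1 ≤ r) :
    SobolevW r (_root_.perInt^[r] G) := by
  obtain ⟨k, rfl⟩ : ∃ k, r = k + 1 := ⟨r - 1, by omega⟩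
  have h := hG.perInt.contDiff_iterate_perInt hG.continuous_perInt k
  refine ⟨(hG.iterate_perInt _).periodic, ?_, G, hG.integrable, .of_forall hG2, fun x => ?_⟩
  · exact h.1
  · simp only [add_tsub_cancel_right, Function.iterate_succ_apply, h.2]
    unfold _root_.perInt
    simp
    ring

end PerZero

namespace PtsColl

variable {s : ℕ} (Y : PtsColl s)

lemma anti {i j : ℕ} (hij : i ≤ j) (hj : j ≤ 2 * s) : Y.y j ≤ Y.y i := by
  induction j, hij using Nat.le_induction with
  | base => exact le_rfl
  | succ j hij ih => exact (Y.lt (j + 1) (by omega) hj).le.trans (ih (by omega))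

lemma y_zero_le (hs : 1 ≤ s) : Y.y 0 ≤ Y.y 2 + 2 * Real.pi := by
  rw [Y.per]
  linarith [Y.anti (i := 2) (j := 2 * s) (by omega) le_rfl]

end PtsColl

lemma QMonotoneOn.iteratedDeriv_nonneg {q : ℕ} (hq : 2 ≤ q) {f : ℝ → ℝ} {a b : ℝ}
    (h : QMonotoneOn q f a b) (hf : ∀ m : ℕ, ContDiff ℝ m f) {x : ℝ} (hx : x ∈ Set.Ioo a b) :
    0 ≤ iteratedDeriv q f x := by
  obtain ⟨k, rfl⟩ : ∃ k, q = k + 2 := ⟨q - 2, by omega⟩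
  have hc : ConvexOn ℝ (Set.Ioo a b) (iteratedDeriv k f) :=
    h.2.2.congr (iteratedDerivWithin_of_isOpen isOpen_Ioo)
  have hd : Differentiable ℝ (iteratedDeriv k f) :=
    (hf (k + 1)).differentiable_iteratedDeriv k (by exact_mod_cast Nat.lt_succ_self k)
  have hm := (hc.monotoneOn_deriv fun x _ => hd x).derivWithin_nonneg (x := x)
  rwa [derivWithin_of_isOpen isOpen_Ioo hx, ← iteratedDeriv_succ, ← iteratedDeriv_succ] at hm

lemma DeltaQ.local_sign {q s : ℕ} (hq : 2 ≤ q) (hs : 1 ≤ s) {Y : PtsColl s} {T : ℝ → ℝ}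
    (hT : DeltaQ q s Y T) (hf : ∀ m : ℕ, ContDiff ℝ m T) {ρ : ℝ} (h0 : ρ ≤ Y.y 0 - Y.y 1)
    (h2 : ρ ≤ Y.y 1 - Y.y 2) {x : ℝ} (hx : |x - Y.y 1| < ρ) :
    0 ≤ iteratedDeriv q T x * (x - Y.y 1) := by
  obtain ⟨hx1, hx2⟩ := abs_lt.1 hx
  rcases lt_trichotomy x (Y.y 1) with h | h | h
  · have := (hT.2.2 2 (by omega) (by omega)).iteratedDeriv_nonneg hq
      (fun m => (hf m).const_smul ((-1 : ℝ) ^ (2 - 1)))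
      (x := x) ⟨by linarith, by simpa using h⟩
    rw [iteratedDeriv_const_mul_field] at this
    norm_num at this
    nlinarith
  · simp [h]
  · have := (hT.2.2 1 le_rfl (by omega)).iteratedDeriv_nonneg hq
      (fun m => (hf m).const_smul ((-1 : ℝ) ^ (1 - 1)))
      (x := x) ⟨h, by simp; linarith⟩
    rw [iteratedDeriv_const_mul_field] at this
    norm_num at this
    nlinarith

lemma deltaQ_iterate_perInt {q s : ℕ} (hq : 3 ≤ q) {Y : PtsColl s} {S : ℝ → ℝ} (hS : PerZero S)
    (h : ∀ i, 1 ≤ i → i ≤ 2 * s → ContinuousOn S (Set.Ioo (Y.y i) (Y.y (i - 1))) ∧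
      ConvexOn ℝ (Set.Ioo (Y.y i) (Y.y (i - 1))) (fun x => (-1 : ℝ) ^ (i - 1) * S x)) :
    DeltaQ q s Y (perInt^[q - 2] S) := by
  obtain ⟨k, rfl⟩ : ∃ k, q = k + 3 := ⟨q - 3, by omega⟩
  have hc : Continuous (perInt^[k + 3 - 2] S) := by
    rw [show k + 3 - 2 = k + 1 by omega, Function.iterate_succ_apply']
    exact (hS.iterate_perInt k).continuous_perInt
  refine ⟨hc, (hS.iterate_perInt _).periodic, fun i h1 h2 => ?_⟩
  have hi := hS.contDiffOn_iterate_perInt isOpen_Ioo (h i h1 h2).1 (k + 3 - 2)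
  refine ⟨(continuous_const.mul hc).continuousOn, contDiffOn_const.mul hi.1, ?_⟩
  refine (h i h1 h2).2.congr fun x hx => ?_
  rw [iteratedDerivWithin_of_isOpen isOpen_Ioo hx]
  simp only [iteratedDeriv_const_mul_field]
  rw [← iteratedDerivWithin_of_isOpen isOpen_Ioo hx, hi.2 hx]

lemma deltaQ_zero (q s : ℕ) (Y : PtsColl s) : DeltaQ q s Y (fun _ => 0) := by
  refine ⟨continuous_const, fun _ => rfl, fun i _ _ => ?_⟩
  simp only [mul_zero]
  refine ⟨continuousOn_const, contDiffOn_const, ?_⟩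
  refine (convexOn_const (0 : ℝ) (convex_Ioo _ _)).congr fun x hx => ?_
  rw [iteratedDerivWithin_of_isOpen isOpen_Ioo hx]
  simp

lemma Function.Periodic.exists_abs_le {f : ℝ → ℝ} (hp : Function.Periodic f (2 * Real.pi))
    (hf : Continuous f) : ∃ C, ∀ x, |f x| ≤ C := by
  obtain ⟨C, hC⟩ := (isCompact_Icc (a := (0 : ℝ)) (b := 2 * Real.pi)).exists_bound_of_continuousOn
    hf.continuousOn
  refine ⟨C, fun x => ?_⟩
  obtain ⟨z, hz, hxz⟩ := hp.exists_mem_Ico₀ (by positivity) x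
  rw [hxz]
  exact hC z ⟨hz.1, hz.2.le⟩

lemma le_errCoQ {q n s : ℕ} {Y : PtsColl s} {f : ℝ → ℝ} {c : ℝ} (hf : Continuous f)
    (hp : Function.Periodic f (2 * Real.pi))
    (h : ∀ T, IsTrigPoly n T → DeltaQ q s Y T → ∃ x, c ≤ |f x - T x|) : c ≤ ErrCoQ q n s Y f := by
  refine le_csInf ⟨_, fun _ => 0, ⟨⟨fun _ => 0, fun _ => 0, by simp⟩, deltaQ_zero q s Y⟩, rfl⟩ ?_
  rintro _ ⟨T, ⟨hT, hTD⟩, rfl⟩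
  obtain ⟨x, hx⟩ := h T hT hTD
  have hpd : Function.Periodic (fun x => f x - T x) (2 * Real.pi) := fun x => by
    simp only [hp x, hTD.2.1 x]
  obtain ⟨C, hC⟩ := hpd.exists_abs_le (hf.sub hTD.1)
  exact hx.trans (le_ciSup (f := fun x => |f x - T x|) ⟨C, by rintro _ ⟨x, rfl⟩; exact hC x⟩ x)

lemma abs_integral_mul_sub_le {f T ψ : ℝ → ℝ} (hf : Continuous f) (hT : Continuous T)
    (hψ : Continuous ψ) {E a b : ℝ} (hab : a ≤ b) (hE : ∀ x, |f x - T x| ≤ E) :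
    |(∫ x in a..b, f x * ψ x) - ∫ x in a..b, T x * ψ x| ≤ E * ∫ x in a..b, |ψ x| := by
  have h1 : Continuous fun x => f x * ψ x := hf.mul hψ
  have h2 : Continuous fun x => T x * ψ x := hT.mul hψ
  rw [← intervalIntegral.integral_sub (h1.intervalIntegrable _ _) (h2.intervalIntegrable _ _),
    ← intervalIntegral.integral_const_mul]
  refine (intervalIntegral.abs_integral_le_integral_abs hab).trans ?_
  refine intervalIntegral.integral_mono_on hab
    ((by fun_prop : Continuous _).intervalIntegrable _ _)
    ((by fun_prop : Continuous _).intervalIntegrable _ _) fun x _ => ?_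
  rw [← sub_mul, abs_mul]
  exact mul_le_mul_of_nonneg_right (hE x) (abs_nonneg _)

lemma integral_mul_deriv3_of_affine {y κ e a b : ℝ} {φ H : ℝ → ℝ} (hφ : IsTest y φ) (hab : a ≤ b)
    (hH : Continuous H) (hd : ∀ x ∈ Set.Ioo a b, HasDerivAt H (κ * (x - e)) x) :
    ∫ x in a..b, H x * deriv (deriv (deriv φ)) x =
      (H b * deriv (deriv φ) b - κ * (b - e) * deriv φ b + κ * φ b) -
      (H a * deriv (deriv φ) a - κ * (a - e) * deriv φ a + κ * φ a) := by
  have c3 := (hφ.deriv.deriv.deriv.contDiff 0).continuous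
  have c2 := (hφ.deriv.deriv.contDiff 0).continuous
  have c1 := (hφ.deriv.contDiff 0).continuous
  have h1 := intervalIntegral.integral_mul_deriv_eq_deriv_mul_of_hasDeriv_right
    (a := a) (b := b) (u := H) (v := deriv (deriv φ)) (u' := fun x => κ * (x - e))
    (v' := deriv (deriv (deriv φ)))
    hH.continuousOn c2.continuousOn
    (fun x hx => by
      rw [min_eq_left hab, max_eq_right hab] at hx
      exact (hd x hx).hasDerivWithinAt)
    (fun x _ => (hφ.deriv.deriv.differentiable x).hasDerivAt.hasDerivWithinAt)
    ((by fun_prop : Continuous _).intervalIntegrable _ _) (c3.intervalIntegrable _ _)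
  have h2 := intervalIntegral.integral_mul_deriv_eq_deriv_mul
    (a := a) (b := b) (u := fun x => κ * (x - e)) (v := deriv φ) (u' := fun _ => κ)
    (v' := deriv (deriv φ))
    (fun x _ => by simpa using ((hasDerivAt_id x).sub_const e).const_mul κ)
    (fun x _ => (hφ.deriv.differentiable x).hasDerivAt)
    (by simp) (c2.intervalIntegrable _ _)
  have h3 : ∫ x in a..b, deriv φ x = φ b - φ a :=
    intervalIntegral.integral_deriv_eq_sub (fun t _ => hφ.differentiable t)
      (c1.intervalIntegrable _ _)
  rw [intervalIntegral.integral_const_mul, h3] at h2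
  rw [h1, h2]
  ring

/-- The sawtooth of period `2π` and slope `-c / (2π)` that jumps by `c` at `y`. -/
def sawtooth (y c x : ℝ) : ℝ := -c * (Int.fract ((x - y) / (2 * Real.pi)) - 1 / 2)

lemma sawtooth_eq_right {y c x : ℝ} (h1 : y ≤ x) (h2 : x < y + 2 * Real.pi) :
    sawtooth y c x = -c / (2 * Real.pi) * (x - (y + Real.pi)) := by
  have hpi := Real.pi_pos
  rw [sawtooth, Int.fract_eq_self.2 ⟨div_nonneg (by linarith) (by positivity), by
    rw [div_lt_one (by positivity)]; linarith⟩]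
  field_simp
  ring

lemma sawtooth_periodic (y c : ℝ) : Function.Periodic (sawtooth y c) (2 * Real.pi) := by
  intro x
  have hpi := Real.pi_pos
  have : (x + 2 * Real.pi - y) / (2 * Real.pi) = (x - y) / (2 * Real.pi) + 1 := by
    field_simp; ring
  rw [sawtooth, this, Int.fract_add_one, sawtooth]

lemma sawtooth_eq_left {y c x : ℝ} (h1 : y - 2 * Real.pi ≤ x) (h2 : x < y) :
    sawtooth y c x = -c / (2 * Real.pi) * (x - (y - Real.pi)) := by
  rw [← sawtooth_periodic y c x, sawtooth_eq_right (by linarith) (by linarith)]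
  ring

lemma abs_sawtooth_le (y : ℝ) {c : ℝ} (hc : 0 ≤ c) (x : ℝ) : |sawtooth y c x| ≤ c := by
  have h1 := Int.fract_nonneg ((x - y) / (2 * Real.pi))
  have h2 := (Int.fract_lt_one ((x - y) / (2 * Real.pi))).le
  rw [sawtooth, abs_le]
  constructor <;> nlinarith

lemma perZero_sawtooth (y : ℝ) {c : ℝ} (hc : 0 ≤ c) : PerZero (sawtooth y c) := by
  have hpi := Real.pi_pos
  have hm : Measurable (sawtooth y c) := by
    unfold sawtooth
    exact ((measurable_fract.comp (by fun_prop)).sub_const _).const_mul _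
  have hi : ∀ a b, IntervalIntegrable (sawtooth y c) MeasureTheory.volume a b := fun a b =>
    (intervalIntegrable_const (c := c)).mono_fun hm.aestronglyMeasurable
      (.of_forall fun x => by
        simpa [Real.norm_eq_abs, abs_of_nonneg hc] using abs_sawtooth_le y hc x)
  refine ⟨sawtooth_periodic y c, hi, ?_⟩
  have := (sawtooth_periodic y c).intervalIntegral_add_eq 0 y
  rw [zero_add] at this
  rw [this]
  have h2 : ∫ x in y..y + 2 * Real.pi, sawtooth y c x =
      ∫ x in y..y + 2 * Real.pi, -c / (2 * Real.pi) * (x - (y + Real.pi)) := by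
    refine intervalIntegral.integral_congr_ae ?_
    have hne : ∀ᵐ x ∂MeasureTheory.volume, x ≠ y + 2 * Real.pi := by
      simp [MeasureTheory.ae_iff]
    filter_upwards [hne] with x hx hxm
    rw [Set.uIoc_of_le (by linarith)] at hxm
    exact sawtooth_eq_right hxm.1.le (lt_of_le_of_ne hxm.2 hx)
  rw [h2, intervalIntegral.integral_const_mul]
  simp
  right
  ring

theorem no_jackson_of_le {q r s : ℕ} (hq : 3 ≤ q) (hr : 1 ≤ r) (hrq : r + 2 ≤ q) (hs : 1 ≤ s)
    (Y : PtsColl s) :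
    ∃ f : ℝ → ℝ, DeltaQ q s Y f ∧ SobolevW r f ∧
      ∀ M : ℝ, ∃ᶠ n : ℕ in Filter.atTop, M < (n : ℝ) ^ r * ErrCoQ q n s Y f := by
  have hpi := Real.pi_pos
  set y := Y.y 1 with hy
  obtain ⟨k, rfl⟩ : ∃ k, q = k + 3 := ⟨q - 3, by omega⟩
  set c : ℝ := 1 / 16 ^ (k + 1) with hc
  have hc0 : 0 < c := by positivity
  have hS := perZero_sawtooth y hc0.le
  set S := sawtooth y c with hSdef
  set f := perInt^[k + 1] S with hf
  have hcf : Continuous f := by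
    rw [hf, Function.iterate_succ_apply']; exact (hS.iterate_perInt k).continuous_perInt
  have hpf : Function.Periodic f (2 * Real.pi) := (hS.iterate_perInt _).periodic
  have y01 := Y.lt 1 le_rfl (by omega)
  have y12 : Y.y 2 < Y.y 1 := Y.lt 2 (by omega) (by omega)
  have y02 := Y.y_zero_le hs
  simp only [tsub_self] at y01
  have hD : DeltaQ (k + 3) s Y f := by
    refine deltaQ_iterate_perInt hq hS fun i h1 h2 => ?_
    have hEq : ∃ e, Set.EqOn S (fun x => -c / (2 * Real.pi) * (x - e))
        (Set.Ioo (Y.y i) (Y.y (i - 1))) := by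
      rcases Nat.lt_or_ge 1 i with hi | hi
      · have a1 := Y.anti (i := i) (j := 2 * s) h2 le_rfl
        have a2 := Y.anti (i := 1) (j := i - 1) (by omega) (by omega)
        have := Y.per
        exact ⟨_, fun x hx => sawtooth_eq_left (by linarith [hx.1]) (by linarith [hx.2])⟩
      · obtain rfl : i = 1 := by omega
        refine ⟨_, fun x hx => sawtooth_eq_right hx.1.le ?_⟩
        have := hx.2
        simp only [tsub_self] at this
        linarith
    obtain ⟨e, he⟩ := hEq
    refine ⟨ContinuousOn.congr (by fun_prop) he, ?_⟩
    refine ConvexOn.congr (f := fun x => (-1 : ℝ) ^ (i - 1) * (-c / (2 * Real.pi) * (x - e))) ?_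
      fun x hx => by rw [he hx]
    refine ⟨convex_Ioo _ _, fun u _ v _ a b _ _ hab => le_of_eq ?_⟩
    simp only [smul_eq_mul]
    obtain rfl : a = 1 - b := by linarith
    ring
  have hW : SobolevW r f := by
    rw [hf, show k + 1 = r + (k + 1 - r) by omega, Function.iterate_add_apply]
    refine (hS.iterate_perInt _).sobolevW (fun x => ?_) hr
    refine (hS.abs_iterate_perInt_le (abs_sawtooth_le y hc0.le) _ x).trans ?_
    have : (16 : ℝ) ^ (k + 1 - r) ≤ 16 ^ (k + 1) :=
      pow_le_pow_right₀ (by norm_num) (Nat.sub_le _ _)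
    rw [hc, mul_one_div, div_le_iff₀ (by positivity)]
    linarith [pow_pos (by norm_num : (0 : ℝ) < 16) (k + 1)]
  refine ⟨f, hD, hW, ?_⟩
  obtain ⟨ρ, hρ0, hρπ, hρ1, hρ2⟩ : ∃ ρ, 0 < ρ ∧ ρ < Real.pi ∧ ρ ≤ Y.y 0 - Y.y 1 ∧
      ρ ≤ Y.y 1 - Y.y 2 :=
    ⟨min (Real.pi / 2) (min (Y.y 0 - Y.y 1) (Y.y 1 - Y.y 2)),
      lt_min (by linarith) (lt_min (by linarith) (by linarith)),
      (min_le_left _ _).trans_lt (by linarith), (min_le_right _ _).trans (min_le_left _ _),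
      (min_le_right _ _).trans (min_le_right _ _)⟩
  obtain ⟨χ, hχ⟩ := exists_isCutoff y hρ0
  set φ : ℝ → ℝ := fun x => (x - y) * χ x with hφdef
  have hφ : IsTest y φ := hχ.isTest_mul hρπ
  have hχy : χ y = 1 := hχ.eq_one y (by simp; linarith)
  have hφy : deriv φ y = 1 := by
    have hdχ : HasDerivAt χ (deriv χ y) y := ((hχ.contDiff 1).differentiable (by simp) y).hasDerivAt
    have := (((hasDerivAt_id y).sub_const y).mul hdχ).deriv
    simp only [id, sub_self, zero_mul, add_zero, one_mul, hχy] at this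
    exact this
  have hH := hS.continuous_perInt
  have hLf : (-1) ^ (k + 3) * ∫ x in (y - Real.pi)..(y + Real.pi), f x * iteratedDeriv (k + 3) φ x
      = -c := by
    have hit := hS.perInt.contDiff_iterate_perInt hH k
    have e1 := hφ.deriv.deriv.deriv.integral_iteratedDeriv_mul hit.1
    rw [hit.2, ← iteratedDeriv_succ', ← iteratedDeriv_succ', ← iteratedDeriv_succ',
      ← Function.iterate_succ_apply] at e1
    have e2 : ∫ x in (y - Real.pi)..(y + Real.pi), perInt S x * deriv (deriv (deriv φ)) x = c := by
      have hcc : Continuous fun x => perInt S x * deriv (deriv (deriv φ)) x :=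
        hH.mul (hφ.deriv.deriv.deriv.contDiff 0).continuous
      rw [← intervalIntegral.integral_add_adjacent_intervals (b := y)
        (hcc.intervalIntegrable _ _) (hcc.intervalIntegrable _ _)]
      have hd : ∀ e lo hi : ℝ,
          Set.EqOn S (fun x => -c / (2 * Real.pi) * (x - e)) (Set.Ioo lo hi) →
          ∀ x ∈ Set.Ioo lo hi, HasDerivAt (perInt S) (-c / (2 * Real.pi) * (x - e)) x := by
        intro e lo hi he x hx
        have hca : ContinuousAt S x :=
          (ContinuousOn.congr (by fun_prop) he).continuousAt (isOpen_Ioo.mem_nhds hx)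
        have := hS.hasDerivAt_perInt hca
        rwa [he hx] at this
      rw [integral_mul_deriv3_of_affine hφ (by linarith) hH
          (hd (y - Real.pi) (y - Real.pi) y fun x hx =>
            sawtooth_eq_left (by linarith [hx.1]) hx.2),
        integral_mul_deriv3_of_affine hφ (by linarith) hH
          (hd (y + Real.pi) y (y + Real.pi) fun x hx =>
            sawtooth_eq_right hx.1.le (by linarith [hx.2])),
        hφ.eq_zero_left, hφ.eq_zero_right, hφ.deriv.eq_zero_left, hφ.deriv.eq_zero_right,
        hφ.deriv.deriv.eq_zero_left, hφ.deriv.deriv.eq_zero_right, hφy]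
      field_simp
      ring
    rw [e2] at e1
    rw [pow_add, mul_assoc, mul_comm ((-1 : ℝ) ^ 3), ← mul_assoc, ← e1]
    ring
  set C := ∫ x in (y - Real.pi)..(y + Real.pi), |iteratedDeriv (k + 3) φ x| with hC
  have hC0 : 0 ≤ C := intervalIntegral.integral_nonneg (by linarith) fun x _ => abs_nonneg _
  have hcψ : Continuous (iteratedDeriv (k + 3) φ) :=
    (hφ.contDiff (k + 3)).continuous_iteratedDeriv _ le_rfl
  have hlow : ∀ n, c / (C + 1) ≤ ErrCoQ (k + 3) n s Y f := by
    intro n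
    refine le_errCoQ hcf hpf fun T hT hTD => ?_
    by_contra! hcon
    have h1 := abs_integral_mul_sub_le hcf hTD.1 hcψ (by linarith : y - Real.pi ≤ y + Real.pi)
      fun x => (hcon x).le
    have h2 := hφ.integral_iteratedDeriv_mul (hT.contDiff (m := ((k + 3 : ℕ) : WithTop ℕ∞)))
    have h3 : 0 ≤ ∫ x in (y - Real.pi)..(y + Real.pi), iteratedDeriv (k + 3) T x * φ x := by
      refine intervalIntegral.integral_nonneg (by linarith) fun x _ => ?_
      rw [hφdef, ← mul_assoc]
      rcases lt_or_ge |x - y| ρ with h | h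
      · exact mul_nonneg (hTD.local_sign (by omega) hs (fun m => hT.contDiff) hρ1 hρ2 h)
          (hχ.nonneg x)
      · simp [hχ.eq_zero x h]
    rw [h2] at h3
    have h4 : c / (C + 1) * C < c := by
      rw [div_mul_eq_mul_div, div_lt_iff₀ (by positivity)]
      nlinarith
    rw [← hC] at h1
    rw [abs_le] at h1
    rcases neg_one_pow_eq_or ℝ (k + 3) with hsgn | hsgn <;> rw [hsgn] at hLf h3 <;> linarith [h1.1, h1.2]
  intro M
  refine (Filter.Eventually.frequently ?_)
  have ht : Filter.Tendsto (fun n : ℕ => (n : ℝ) * (c / (C + 1))) Filter.atTop Filter.atTop :=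
    tendsto_natCast_atTop_atTop.atTop_mul_const (by positivity)
  filter_upwards [ht.eventually_gt_atTop M, Filter.eventually_ge_atTop 1] with n h1 h2
  have h2' : (1 : ℝ) ≤ n := by exact_mod_cast h2
  refine h1.trans_le ?_
  have : (n : ℝ) ≤ n ^ r := le_self_pow₀ h2' (by omega)
  exact mul_le_mul this (hlow n) (by positivity) (by positivity)

lemma abs_iteratedDeriv_const_le (l : ℕ) (c x : ℝ) : |iteratedDeriv l (fun _ : ℝ => c) x| ≤ |c| := by
  rcases l with _ | l <;> simp [iteratedDeriv_const]

lemma exists_abs_iteratedDeriv_smoothTransition_le (l : ℕ) :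
    ∃ C, 0 ≤ C ∧ ∀ x, |iteratedDeriv l Real.smoothTransition x| ≤ C := by
  obtain ⟨C, hC⟩ := (isCompact_Icc (a := (0 : ℝ)) (b := 1)).exists_bound_of_continuousOn
    ((Real.smoothTransition.contDiff (n := l)).continuous_iteratedDeriv l le_rfl).continuousOn
  have key : ∀ c x : ℝ, |c| ≤ 1 → Real.smoothTransition =ᶠ[nhds x] (fun _ => c) →
      |iteratedDeriv l Real.smoothTransition x| ≤ 1 := fun c x hc h => by
    rw [h.iteratedDeriv_eq]
    exact (abs_iteratedDeriv_const_le l c x).trans hc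
  refine ⟨max C 1, by positivity, fun x => ?_⟩
  rcases lt_or_ge x 0 with h | h
  · refine (key 0 x (by simp) ?_).trans (le_max_right _ _)
    filter_upwards [Iio_mem_nhds h] with z hz
    exact Real.smoothTransition.zero_of_nonpos hz.le
  rcases lt_or_ge 1 x with h' | h'
  · refine (key 1 x (by simp) ?_).trans (le_max_right _ _)
    filter_upwards [Ioi_mem_nhds h'] with z hz
    exact Real.smoothTransition.one_of_one_le hz.le
  · exact (hC x ⟨h, h'⟩).trans (le_max_left _ _)

/-- The `2π`-periodic function which agrees with `x ↦ g (x - y)` on `[y, y + 2π)`. -/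
def perExt (y : ℝ) (g : ℝ → ℝ) (x : ℝ) : ℝ := g (2 * Real.pi * Int.fract ((x - y) / (2 * Real.pi)))

section perExt

variable {y : ℝ} {g : ℝ → ℝ}

lemma perExt_periodic (y : ℝ) (g : ℝ → ℝ) : Function.Periodic (perExt y g) (2 * Real.pi) := by
  intro x
  have : (x + 2 * Real.pi - y) / (2 * Real.pi) = (x - y) / (2 * Real.pi) + 1 := by
    field_simp; ring
  rw [perExt, this, Int.fract_add_one, perExt]

lemma perExt_eq {x : ℝ} (m : ℤ) (h1 : y + 2 * Real.pi * m ≤ x) (h2 : x < y + 2 * Real.pi * (m + 1)) :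
    perExt y g x = g (x - (y + 2 * Real.pi * m)) := by
  have hpi := Real.pi_pos
  have : ⌊(x - y) / (2 * Real.pi)⌋ = m := by
    rw [Int.floor_eq_iff, le_div_iff₀ (by positivity), div_lt_iff₀ (by positivity)]
    constructor <;> linarith
  rw [perExt, Int.fract, this]
  congr 1
  field_simp
  ring

lemma perExt_eventuallyEq {ε : ℝ} (hε : 0 < ε) (h0 : ∀ t, |t| < ε → g t = 0)
    (h1 : ∀ t, |t - 2 * Real.pi| < ε → g t = 0) (x : ℝ) :
    ∃ c, perExt y g =ᶠ[nhds x] fun z => g (z - c) := by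
  have hpi := Real.pi_pos
  set m := ⌊(x - y) / (2 * Real.pi)⌋ with hm
  obtain ⟨hm1, hm2⟩ := Int.floor_eq_iff.1 hm.symm
  rw [le_div_iff₀ (by positivity)] at hm1
  rw [div_lt_iff₀ (by positivity)] at hm2
  refine ⟨y + 2 * Real.pi * m, ?_⟩
  rcases hm1.lt_or_eq with h | h
  · filter_upwards [Ioo_mem_nhds (show y + 2 * Real.pi * m < x by linarith)
      (show x < y + 2 * Real.pi * (m + 1) by linarith)] with z hz
    exact perExt_eq m hz.1.le hz.2
  · have hd : 0 < min ε (2 * Real.pi) := by positivity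
    have e1 := min_le_left ε (2 * Real.pi)
    have e2 := min_le_right ε (2 * Real.pi)
    filter_upwards [Ioo_mem_nhds (show x - min ε (2 * Real.pi) < x by linarith)
      (show x < x + min ε (2 * Real.pi) by linarith)] with z hz
    obtain ⟨hz1, hz2⟩ := hz
    rw [h0 (z - _) (by rw [abs_lt]; constructor <;> linarith)]
    rcases lt_or_ge z x with h' | h'
    · rw [perExt_eq (m - 1) (by push_cast; linarith) (by push_cast; linarith)]
      exact h1 _ (by push_cast; rw [abs_lt]; constructor <;> linarith)
    · rw [perExt_eq m (by linarith) (by linarith)]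
      exact h0 _ (by rw [abs_lt]; constructor <;> linarith)

end perExt

/-- A smooth periodic function which, over one period starting at `y`, rises from `0` to `1`
on `[y + b, y + 2b]` and goes back to `0` on `[y + 2π - 2d, y + 2π - d]`. -/
structure IsStep (y d b : ℝ) (u : ℝ → ℝ) : Prop where
  contDiff : ∀ m : ℕ, ContDiff ℝ m u
  periodic : Function.Periodic u (2 * Real.pi)
  abs_le : ∀ x, |u x| ≤ 1
  eq_zero : ∀ x, -d < x - y → x - y < b → u x = 0
  eq_one : ∀ x, 3 * b / 2 ≤ x - y → x - y ≤ 2 * Real.pi - 2 * d → u x = 1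
  monotoneOn : MonotoneOn u (Set.Icc y (y + 2 * Real.pi - 2 * d))
  antitoneOn : AntitoneOn u (Set.Ico (y + 2 * b) (y + 2 * Real.pi))

lemma exists_isStep (l : ℕ) (y : ℝ) {d : ℝ} (hd : 0 < d) (hdπ : d ≤ Real.pi / 4) :
    ∃ C, 0 ≤ C ∧ ∀ b, 0 < b → b ≤ d →
      ∃ u, IsStep y d b u ∧ ∀ x, |iteratedDeriv l u x| ≤ C * (1 / b) ^ l := by
  have hpi := Real.pi_pos
  obtain ⟨C, hC0, hC⟩ := exists_abs_iteratedDeriv_smoothTransition_le l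
  refine ⟨2 ^ l * C + C, by positivity, fun b hb hbd => ?_⟩
  set st := Real.smoothTransition with hst
  have hmono : Monotone st := Real.smoothTransition.monotone
  set g : ℝ → ℝ := fun t => st (2 / b * t + -2) - st (1 / d * t + (2 - 2 * Real.pi / d)) with hg
  have a0 : ∀ t, t ≤ b → st (2 / b * t + -2) = 0 := fun t ht =>
    Real.smoothTransition.zero_of_nonpos (by
      have : 2 / b * t ≤ 2 / b * b := by gcongr
      rw [div_mul_cancel₀ _ hb.ne'] at this
      linarith)
  have a1 : ∀ t, 3 * b / 2 ≤ t → st (2 / b * t + -2) = 1 := fun t ht =>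
    Real.smoothTransition.one_of_one_le (by
      have : 2 / b * (3 * b / 2) ≤ 2 / b * t := by gcongr
      have e : 2 / b * (3 * b / 2) = 3 := by field_simp
      linarith)
  have c0 : ∀ t, t ≤ 2 * Real.pi - 2 * d → st (1 / d * t + (2 - 2 * Real.pi / d)) = 0 := fun t ht =>
    Real.smoothTransition.zero_of_nonpos (by
      have : 1 / d * t ≤ 1 / d * (2 * Real.pi - 2 * d) := by gcongr
      have e : 1 / d * (2 * Real.pi - 2 * d) = 2 * Real.pi / d - 2 := by field_simp
      linarith)
  have c1 : ∀ t, 2 * Real.pi - d ≤ t → st (1 / d * t + (2 - 2 * Real.pi / d)) = 1 := fun t ht =>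
    Real.smoothTransition.one_of_one_le (by
      have : 1 / d * (2 * Real.pi - d) ≤ 1 / d * t := by gcongr
      have e : 1 / d * (2 * Real.pi - d) = 2 * Real.pi / d - 1 := by field_simp
      linarith)
  have hs1 : ∀ m : ℕ, ContDiff ℝ m fun t => st (2 / b * t + -2) := fun m =>
    Real.smoothTransition.contDiff.comp (by fun_prop)
  have hs2 : ∀ m : ℕ, ContDiff ℝ m fun t => st (1 / d * t + (2 - 2 * Real.pi / d)) := fun m =>
    Real.smoothTransition.contDiff.comp (by fun_prop)
  have hgs : ∀ m : ℕ, ContDiff ℝ m g := fun m => (hs1 m).sub (hs2 m)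
  have hgd : ∀ t, |iteratedDeriv l g t| ≤ (2 ^ l * C + C) * (1 / b) ^ l := by
    intro t
    have hlin : ∀ k e : ℝ, iteratedDeriv l (fun t => st (k * t + e)) t =
        k ^ l * iteratedDeriv l st (k * t + e) := by
      intro k e
      have := congrFun (iteratedDeriv_comp_const_mul (n := l) (f := fun z => st (z + e))
        ((Real.smoothTransition.contDiff.comp (by fun_prop) : ContDiff ℝ l _)) k) t
      simp only [iteratedDeriv_comp_add_const] at this
      simpa using this
    have e1 : |iteratedDeriv l g t| ≤ (2 / b) ^ l * C + (1 / d) ^ l * C := by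
      rw [hg, iteratedDeriv_fun_sub (hs1 l).contDiffAt (hs2 l).contDiffAt, hlin, hlin]
      refine (abs_sub _ _).trans ?_
      rw [abs_mul, abs_mul, abs_of_nonneg (by positivity : 0 ≤ (2 / b) ^ l),
        abs_of_nonneg (by positivity : 0 ≤ (1 / d) ^ l)]
      exact add_le_add (mul_le_mul_of_nonneg_left (hC _) (by positivity))
        (mul_le_mul_of_nonneg_left (hC _) (by positivity))
    have e2 : (1 / d) ^ l ≤ (1 / b) ^ l := by gcongr
    have e3 : (2 / b) ^ l = 2 ^ l * (1 / b) ^ l := by rw [← mul_pow, mul_one_div]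
    rw [e3] at e1
    nlinarith
  have hev := perExt_eventuallyEq (y := y) (g := g) hb
    (fun t ht => by
      have := (abs_lt.1 ht).2
      simp only [hg, a0 t this.le, c0 t (by linarith), sub_self])
    (fun t ht => by
      have := (abs_lt.1 ht).1
      simp only [hg, a1 t (by linarith), c1 t (by linarith), sub_self])
  have hR : ∀ x, y ≤ x → x < y + 2 * Real.pi → perExt y g x = g (x - y) := fun x h1 h2 => by
    have := perExt_eq (y := y) (g := g) (x := x) 0 (by simpa) (by simpa)
    simpa using this
  refine ⟨perExt y g, ⟨?_, perExt_periodic y g, ?_, ?_, ?_, ?_, ?_⟩, ?_⟩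
  · intro m
    rw [contDiff_iff_contDiffAt]
    intro x
    obtain ⟨c, hc⟩ := hev x
    exact ContDiffAt.congr_of_eventuallyEq
      ((hgs m).comp (contDiff_id.sub contDiff_const)).contDiffAt hc
  · intro x
    have hgb : ∀ t, |g t| ≤ 1 := fun t => abs_le.2
      ⟨by linarith [Real.smoothTransition.nonneg (2 / b * t + -2),
          Real.smoothTransition.le_one (1 / d * t + (2 - 2 * Real.pi / d))],
        by linarith [Real.smoothTransition.le_one (2 / b * t + -2),
          Real.smoothTransition.nonneg (1 / d * t + (2 - 2 * Real.pi / d))]⟩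
    exact hgb _
  · intro x h1 h2
    rcases lt_or_ge x y with h | h
    · rw [← perExt_periodic y g x, hR _ (by linarith) (by linarith)]
      simp only [hg]
      rw [a1 _ (by linarith), c1 _ (by linarith), sub_self]
    · rw [hR _ h (by linarith)]
      simp only [hg]
      rw [a0 _ (by linarith), c0 _ (by linarith), sub_self]
  · intro x h1 h2
    rw [hR _ (by linarith) (by linarith)]
    simp only [hg]
    rw [a1 _ (by linarith), c0 _ (by linarith), sub_zero]
  · intro x hx z hz hxz
    rw [hR _ hx.1 (by linarith [hx.2]), hR _ hz.1 (by linarith [hz.2])]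
    simp only [hg]
    rw [c0 _ (by linarith [hx.2]), c0 _ (by linarith [hz.2]), sub_zero, sub_zero]
    exact hmono (by gcongr)
  · intro x hx z hz hxz
    rw [hR _ (by linarith [hx.1]) hx.2, hR _ (by linarith [hz.1]) hz.2]
    simp only [hg]
    rw [a1 (x - y) (by linarith [hx.1]), a1 (z - y) (by linarith [hz.1])]
    have : st (1 / d * (x - y) + (2 - 2 * Real.pi / d)) ≤
      st (1 / d * (z - y) + (2 - 2 * Real.pi / d)) := hmono (by gcongr)
    linarith
  · intro x
    obtain ⟨c, hc⟩ := hev x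
    rw [hc.iteratedDeriv_eq, iteratedDeriv_comp_sub_const]
    exact hgd _

namespace IsStep

variable {y d b : ℝ} {u : ℝ → ℝ}

lemma differentiable (hu : IsStep y d b u) : Differentiable ℝ u :=
  (hu.contDiff 1).differentiable (by simp)

lemma continuous_deriv (hu : IsStep y d b u) : Continuous (deriv u) :=
  (hu.contDiff 1).continuous_deriv le_rfl

lemma deriv_eq_zero_of_near (hu : IsStep y d b u) {x : ℝ} (h1 : -d < x - y) (h2 : x - y < b) :
    deriv u x = 0 := by
  have : u =ᶠ[nhds x] fun _ => 0 := by
    filter_upwards [Ioo_mem_nhds (show y - d < x by linarith) (show x < y + b by linarith)]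
      with z hz
    exact hu.eq_zero z (by linarith [hz.1]) (by linarith [hz.2])
  simp [this.deriv_eq]

lemma deriv_eq_zero_of_far (hu : IsStep y d b u) {x : ℝ} (h1 : 3 * b / 2 < x - y)
    (h2 : x - y < 2 * Real.pi - 2 * d) : deriv u x = 0 := by
  have : u =ᶠ[nhds x] fun _ => 1 := by
    filter_upwards [Ioo_mem_nhds (show y + 3 * b / 2 < x by linarith)
      (show x < y + (2 * Real.pi - 2 * d) by linarith)] with z hz
    exact hu.eq_one z (by linarith [hz.1]) (by linarith [hz.2])
  simp [this.deriv_eq]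

lemma deriv_nonneg (hu : IsStep y d b u) {x : ℝ} (h1 : y < x) (h2 : x < y + 2 * Real.pi - 2 * d) :
    0 ≤ deriv u x := by
  have := (hu.monotoneOn.mono Set.Ioo_subset_Icc_self).derivWithin_nonneg (x := x)
  rwa [derivWithin_of_isOpen isOpen_Ioo ⟨h1, h2⟩] at this

lemma integral_deriv_mul (hu : IsStep y d b u) (hb : 0 < b) (hbd : b ≤ d) (hd : d ≤ Real.pi / 4)
    {ρ : ℝ} (hρd : ρ ≤ d) {ψ : ℝ → ℝ} (hψ : Continuous ψ) (h0 : ∀ x, ρ ≤ |x - y| → ψ x = 0) :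
    ∫ x in (y - Real.pi)..(y + Real.pi), deriv u x * ψ x =
      ∫ x in y..(y + 2 * b), deriv u x * ψ x := by
  have hpi := Real.pi_pos
  have hc : Continuous fun x => deriv u x * ψ x := hu.continuous_deriv.mul hψ
  have hz : ∀ x, x ≤ y ∨ (y + 2 * b ≤ x ∧ x ≤ y + Real.pi) → deriv u x * ψ x = 0 := by
    rintro x (h | ⟨h1, h2⟩)
    · rcases lt_or_ge |x - y| ρ with h' | h'
      · rw [hu.deriv_eq_zero_of_near (by linarith [(abs_lt.1 h').1]) (by linarith), zero_mul]
      · rw [h0 x h', mul_zero]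
    · rw [hu.deriv_eq_zero_of_far (by linarith) (by linarith), zero_mul]
  rw [← intervalIntegral.integral_add_adjacent_intervals (b := y)
      (hc.intervalIntegrable _ _) (hc.intervalIntegrable _ _),
    ← intervalIntegral.integral_add_adjacent_intervals (a := y) (b := y + 2 * b)
      (hc.intervalIntegrable _ _) (hc.intervalIntegrable _ _),
    intervalIntegral.integral_congr (g := fun _ => 0) (a := y - Real.pi) fun x hx => ?_,
    intervalIntegral.integral_congr (g := fun _ => 0) (a := y + 2 * b) fun x hx => ?_]
  · simp
  · rw [Set.uIcc_of_le (by linarith)] at hx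
    exact hz x (.inr hx)
  · rw [Set.uIcc_of_le (by linarith)] at hx
    exact hz x (.inl hx.2)

lemma integral_deriv (hu : IsStep y d b u) (hb : 0 < b) (hbd : b ≤ d) (hd : d ≤ Real.pi / 4) :
    ∫ x in y..(y + 2 * b), deriv u x = 1 := by
  rw [intervalIntegral.integral_deriv_eq_sub (fun x _ => hu.differentiable x)
    (hu.continuous_deriv.intervalIntegrable _ _), hu.eq_one _ (by linarith)
    (by linarith [Real.pi_pos]), hu.eq_zero _ (by linarith) (by linarith), sub_zero]

variable {ρ : ℝ} {χ : ℝ → ℝ}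

lemma integral_deriv_mul_cutoff (hu : IsStep y d b u) (hb : 0 < b) (hbd : b ≤ d)
    (hd : d ≤ Real.pi / 4) (hρd : ρ ≤ d) (hbρ : 4 * b ≤ ρ) (hχ : IsCutoff y ρ χ) :
    ∫ x in (y - Real.pi)..(y + Real.pi), deriv u x * χ x = 1 := by
  rw [hu.integral_deriv_mul hb hbd hd hρd (hχ.contDiff 0).continuous hχ.eq_zero,
    ← hu.integral_deriv hb hbd hd]
  refine intervalIntegral.integral_congr fun x hx => ?_
  rw [Set.uIcc_of_le (by linarith)] at hx
  rw [hχ.eq_one x (by rw [_root_.abs_le]; constructor <;> linarith [hx.1, hx.2]), mul_one]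

lemma integral_deriv_mul_sub_mul_cutoff_le (hu : IsStep y d b u) (hb : 0 < b) (hbd : b ≤ d)
    (hd : d ≤ Real.pi / 4) (hρd : ρ ≤ d) (hbρ : 4 * b ≤ ρ) (hχ : IsCutoff y ρ χ) :
    ∫ x in (y - Real.pi)..(y + Real.pi), deriv u x * ((x - y) * χ x) ≤ 2 * b := by
  have hpi := Real.pi_pos
  have hcχ := (hχ.contDiff 0).continuous
  have hcu := hu.continuous_deriv
  rw [hu.integral_deriv_mul hb hbd hd hρd (by fun_prop) fun x hx => by rw [hχ.eq_zero x hx, mul_zero]]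
  have : ∫ x in y..(y + 2 * b), deriv u x * (2 * b) = 2 * b := by
    rw [intervalIntegral.integral_mul_const, hu.integral_deriv hb hbd hd, one_mul]
  refine le_of_le_of_eq ?_ this
  have h1 : Continuous fun x => deriv u x * ((x - y) * χ x) := by fun_prop
  have h2 : Continuous fun x => deriv u x * (2 * b) := by fun_prop
  refine intervalIntegral.integral_mono_on (by linarith) (h1.intervalIntegrable _ _)
    (h2.intervalIntegrable _ _) fun x hx => ?_
  rw [hχ.eq_one x (by rw [_root_.abs_le]; constructor <;> linarith [hx.1, hx.2]), mul_one]
  rcases hx.1.lt_or_eq with h | h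
  · exact mul_le_mul_of_nonneg_left (by linarith [hx.2])
      (hu.deriv_nonneg h (by linarith [hx.2]))
  · rw [hu.deriv_eq_zero_of_near (by linarith) (by linarith), zero_mul, zero_mul]

lemma monotoneOn_piece {s : ℕ} {Y : PtsColl s} (hs : 1 ≤ s) (hu : IsStep (Y.y 1) d b u)
    (hb : 0 < b) (hbd : b ≤ d) (h01 : 2 * d ≤ Y.y 0 - Y.y 1) (h12 : 2 * d ≤ Y.y 1 - Y.y 2)
    {i : ℕ} (hi1 : 1 ≤ i) (hi2 : i ≤ 2 * s) :
    MonotoneOn (fun x => (-1 : ℝ) ^ (i - 1) * u x) (Set.Ioo (Y.y i) (Y.y (i - 1))) := by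
  have h0 := Y.y_zero_le hs
  obtain rfl | rfl | hi : i = 1 ∨ i = 2 ∨ 3 ≤ i := by omega
  · simp only [tsub_self, pow_zero, one_mul]
    exact hu.monotoneOn.mono fun x hx => ⟨hx.1.le, by linarith [hx.2]⟩
  · intro x hx z hz hxz
    simp only [Nat.add_one_sub_one, pow_one, neg_mul, one_mul, neg_le_neg_iff] at hx hz ⊢
    rw [← hu.periodic x, ← hu.periodic z]
    exact hu.antitoneOn ⟨by linarith [hx.1], by linarith [hx.2]⟩
      ⟨by linarith [hz.1], by linarith [hz.2]⟩ (by linarith)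
  · have a1 := Y.anti (i := i) (j := 2 * s) hi2 le_rfl
    have a2 := Y.anti (i := 2) (j := i - 1) (by omega) (by omega)
    have := Y.per
    have key : ∀ x ∈ Set.Ioo (Y.y i) (Y.y (i - 1)), u x = 1 := fun x hx => by
      rw [← hu.periodic x]
      exact hu.eq_one _ (by linarith [hx.1]) (by linarith [hx.2])
    intro x hx z hz _
    simp only [key x hx, key z hz, le_refl]

end IsStep

lemma exists_nat_inv_add_pow_mul_lt {c κ : ℝ} (hc : 0 < c) (hκ0 : 0 ≤ κ) (hκ : κ < 1) (A D : ℝ)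
    (p N : ℕ) : ∃ n : ℕ, N ≤ n ∧ 1 ≤ n ∧ A * (1 / n) + D * (n ^ p * κ ^ n) < c := by
  have h1 : Filter.Tendsto (fun n : ℕ => A * (1 / (n : ℝ))) Filter.atTop (nhds 0) := by
    simpa using (tendsto_one_div_atTop_nhds_zero_nat (𝕜 := ℝ)).const_mul A
  have h2 : Filter.Tendsto (fun n : ℕ => D * ((n : ℝ) ^ p * κ ^ n)) Filter.atTop (nhds 0) := by
    simpa using (tendsto_pow_const_mul_const_pow_of_abs_lt_one p
      (by rwa [abs_of_nonneg hκ0])).const_mul D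
  have h3 := (h1.add h2).eventually_lt_const (by simpa using hc)
  obtain ⟨n, hn, hN, h1⟩ := (h3.and ((Filter.eventually_ge_atTop N).and
    (Filter.eventually_ge_atTop 1))).exists
  exact ⟨n, hN, h1, hn⟩

lemma abs_integral_iteratedDeriv_mul_sub_le {y : ℝ} {q : ℕ} {f T ψ : ℝ → ℝ}
    (hf : ∀ m : ℕ, ContDiff ℝ m f) (hT : ∀ m : ℕ, ContDiff ℝ m T) (hψ : IsTest y ψ) {E : ℝ}
    (hE : ∀ x, |f x - T x| ≤ E) :
    |(∫ x in (y - Real.pi)..(y + Real.pi), iteratedDeriv q f x * ψ x) -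
        ∫ x in (y - Real.pi)..(y + Real.pi), iteratedDeriv q T x * ψ x| ≤
      E * ∫ x in (y - Real.pi)..(y + Real.pi), |iteratedDeriv q ψ x| := by
  rw [hψ.integral_iteratedDeriv_mul (hf q), hψ.integral_iteratedDeriv_mul (hT q), ← mul_sub,
    abs_mul, abs_pow, abs_neg, abs_one, one_pow, one_mul]
  exact abs_integral_mul_sub_le (hf 0).continuous (hT 0).continuous
    ((hψ.contDiff q).continuous_iteratedDeriv _ le_rfl) (by linarith [Real.pi_pos]) hE

lemma IsTrigPoly.local_mass_le_of_approx {n q : ℕ} {f T : ℝ → ℝ} (hT : IsTrigPoly n T) (hn : 1 ≤ n)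
    {y ρ M E : ℝ} (hρ : 0 < ρ) (hρπ : ρ < Real.pi) {χ : ℝ → ℝ} (hχ : IsCutoff y ρ χ)
    (hs : ∀ x, |x - y| < ρ → 0 ≤ iteratedDeriv q T x * (x - y))
    (hf : ∀ m : ℕ, ContDiff ℝ m f) (hM : ∀ x, |f x| ≤ M) (hE : ∀ x, |f x - T x| ≤ E) :
    (∫ x in (y - Real.pi)..(y + Real.pi), iteratedDeriv q f x * χ x) -
        E * (∫ x in (y - Real.pi)..(y + Real.pi), |iteratedDeriv q χ x|) ≤
      160 * n * ((∫ x in (y - Real.pi)..(y + Real.pi), iteratedDeriv q f x * ((x - y) * χ x)) +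
        E * (∫ x in (y - Real.pi)..(y + Real.pi), |iteratedDeriv q (fun x => (x - y) * χ x) x|) +
        (Real.cos (ρ / 4) ^ 2) ^ n * ((2 * n + 1) * (n ^ q * (M + E)))) := by
  have hTs : ∀ m : ℕ, ContDiff ℝ m T := fun m => hT.contDiff
  have h1 := abs_le.1 (abs_integral_iteratedDeriv_mul_sub_le (q := q) hf hTs (hχ.isTest hρπ) hE)
  have h2 := abs_le.1 (abs_integral_iteratedDeriv_mul_sub_le (q := q) hf hTs (hχ.isTest_mul hρπ) hE)
  have h3 := hT.local_mass_le hn (B := M + E) hρ hρπ hχ hs fun x => by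
    have := abs_sub_abs_le_abs_sub (T x) (f x)
    rw [abs_sub_comm] at this
    linarith [hM x, hE x]
  refine le_trans ?_ (h3.trans ?_)
  · linarith
  · gcongr
    linarith

lemma PerZero.add {S S' : ℝ → ℝ} (hS : PerZero S) (hS' : PerZero S') :
    PerZero (fun x => S x + S' x) :=
  ⟨fun x => by simp only [hS.periodic x, hS'.periodic x],
    fun a b => (hS.integrable a b).add (hS'.integrable a b), by
      rw [intervalIntegral.integral_add (hS.integrable _ _) (hS'.integrable _ _), hS.mean, hS'.mean,
        add_zero]⟩

lemma PerZero.contDiff_iterate_perInt_of_contDiff {S : ℝ → ℝ} (hS : PerZero S)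
    (hd : ∀ m : ℕ, ContDiff ℝ m S) (k m : ℕ) : ContDiff ℝ m (_root_.perInt^[k] S) := by
  induction k generalizing m with
  | zero => exact hd m
  | succ k ih =>
    rw [Function.iterate_succ_apply']
    have hD : ∀ x, HasDerivAt (_root_.perInt (_root_.perInt^[k] S)) (_root_.perInt^[k] S x) x := fun x =>
      (hS.iterate_perInt k).hasDerivAt_perInt (ih 0).continuous.continuousAt
    have h : ContDiff ℝ ((m : WithTop ℕ∞) + 1) (_root_.perInt (_root_.perInt^[k] S)) :=
      contDiff_succ_iff_deriv.2 ⟨fun x => (hD x).differentiableAt, by simp, by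
        rw [funext fun x => (hD x).deriv]
        exact ih m⟩
    exact h.of_le (by exact_mod_cast Nat.le_succ m)

/-- Smooth periodic functions with the sign pattern of `Δ^(q)(Y_s)` whose `q`-th derivative
vanishes near the point `y 1`. -/
structure IsFlat (q s : ℕ) (Y : PtsColl s) (f : ℝ → ℝ) : Prop where
  contDiff : ∀ m : ℕ, ContDiff ℝ m f
  perZero : PerZero f
  monotoneOn : ∀ i, 1 ≤ i → i ≤ 2 * s →
    MonotoneOn (fun x => (-1 : ℝ) ^ (i - 1) * iteratedDeriv (q - 1) f x)
      (Set.Ioo (Y.y i) (Y.y (i - 1)))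
  flat : ∃ ρ, 0 < ρ ∧ ∀ x, |x - Y.y 1| < ρ → iteratedDeriv q f x = 0

lemma IsFlat.add {q s : ℕ} {Y : PtsColl s} {f g : ℝ → ℝ} (hf : IsFlat q s Y f)
    (hg : IsFlat q s Y g) : IsFlat q s Y (fun x => f x + g x) := by
  have hadd : ∀ m x, iteratedDeriv m (fun x => f x + g x) x =
      iteratedDeriv m f x + iteratedDeriv m g x := fun m x =>
    iteratedDeriv_fun_add (hf.contDiff m).contDiffAt (hg.contDiff m).contDiffAt
  refine ⟨fun m => (hf.contDiff m).add (hg.contDiff m), hf.perZero.add hg.perZero,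
    fun i h1 h2 => ?_, ?_⟩
  · simp only [hadd, mul_add]
    exact (hf.monotoneOn i h1 h2).add (hg.monotoneOn i h1 h2)
  · obtain ⟨ρ, h0, h⟩ := hf.flat
    obtain ⟨ρ', h0', h'⟩ := hg.flat
    refine ⟨min ρ ρ', lt_min h0 h0', fun x hx => ?_⟩
    rw [hadd, h x (hx.trans_le (min_le_left _ _)), h' x (hx.trans_le (min_le_right _ _)), add_zero]

lemma exists_isFlat_hump {q s : ℕ} (hq : 1 ≤ q) (hs : 1 ≤ s) (Y : PtsColl s) (l : ℕ) {d : ℝ}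
    (hd : 0 < d) (hdπ : d ≤ Real.pi / 4) (h01 : 2 * d ≤ Y.y 0 - Y.y 1)
    (h12 : 2 * d ≤ Y.y 1 - Y.y 2) :
    ∃ C, 0 ≤ C ∧ ∀ b m, 0 < b → b ≤ d → 0 ≤ m → ∃ h u, IsFlat q s Y h ∧ IsStep (Y.y 1) d b u ∧
      (∀ x, iteratedDeriv q h x = m * deriv u x) ∧
      ∀ x, |iteratedDeriv (l + (q - 1)) h x| ≤ m * (C * (1 / b) ^ l) := by
  have hpi := Real.pi_pos
  obtain ⟨C, hC0, hC⟩ := exists_isStep l (Y.y 1) hd hdπ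
  refine ⟨C + 1, by positivity, fun b m hb hbd hm => ?_⟩
  obtain ⟨u, hu, hul⟩ := hC b hb hbd
  have hcu : Continuous u := (hu.contDiff 0).continuous
  set μ : ℝ := (∫ x in (0 : ℝ)..(2 * Real.pi), u x) / (2 * Real.pi) with hμ
  have hμ1 : |μ| ≤ 1 := by
    rw [hμ, abs_div, abs_of_pos (by positivity : 0 < 2 * Real.pi), div_le_one (by positivity)]
    have := intervalIntegral.norm_integral_le_of_norm_le_const (a := 0) (b := 2 * Real.pi)
      (f := u) (C := 1) fun x _ => hu.abs_le x
    rwa [sub_zero, abs_of_pos (by positivity : 0 < 2 * Real.pi), one_mul, Real.norm_eq_abs] at this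
  set w : ℝ → ℝ := fun x => m * (u x - μ) with hw
  have hwd : ∀ k : ℕ, ContDiff ℝ k w := fun k =>
    contDiff_const.mul ((hu.contDiff k).sub contDiff_const)
  have hw0 : PerZero w := by
    refine ⟨fun x => by simp only [hw, hu.periodic x],
      fun a b => (hwd 0).continuous.intervalIntegrable _ _, ?_⟩
    simp only [hw]
    rw [intervalIntegral.integral_const_mul, intervalIntegral.integral_sub
      (hcu.intervalIntegrable _ _) intervalIntegrable_const, intervalIntegral.integral_const, hμ]
    simp only [smul_eq_mul]
    field_simp
    ring
  have hit := (hw0.contDiff_iterate_perInt (hwd 0).continuous (q - 1)).2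
  have hdw : ∀ x, deriv w x = m * deriv u x := fun x => by
    have := (((hu.differentiable x).hasDerivAt.sub_const μ).const_mul m).deriv
    exact this
  have hq1 : ∀ x, iteratedDeriv q (perInt^[q - 1] w) x = m * deriv u x := fun x => by
    conv_lhs => rw [show q = (q - 1) + 1 by omega]
    rw [iteratedDeriv_succ, Nat.add_sub_cancel, hit, hdw]
  refine ⟨perInt^[q - 1] w, u, ⟨hw0.contDiff_iterate_perInt_of_contDiff hwd _,
    hw0.iterate_perInt _, fun i h1 h2 => ?_, b, hb, fun x hx => ?_⟩, hu, hq1, fun x => ?_⟩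
  · rw [hit]
    intro x hx z hz hxz
    have := hu.monotoneOn_piece hs hb hbd h01 h12 h1 h2 hx hz hxz
    simp only [hw] at this ⊢
    nlinarith
  · obtain ⟨h1, h2⟩ := abs_lt.1 hx
    rw [hq1, hu.deriv_eq_zero_of_near (by linarith) h2, mul_zero]
  · rw [iteratedDeriv_eq_iterate, Function.iterate_add_apply, ← iteratedDeriv_eq_iterate,
      ← iteratedDeriv_eq_iterate, hit, hw, iteratedDeriv_const_mul_field, abs_mul, abs_of_nonneg hm]
    refine mul_le_mul_of_nonneg_left ?_ hm
    rw [iteratedDeriv_fun_sub (hu.contDiff l).contDiffAt contDiffAt_const]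
    refine (abs_sub _ _).trans ?_
    have h1 : (1 : ℝ) ≤ (1 / b) ^ l := one_le_pow₀ (by
      rw [le_div_iff₀ hb]; linarith [Real.pi_le_four])
    linarith [hul x, abs_iteratedDeriv_const_le l μ x]

lemma PtsColl.exists_gap {s : ℕ} (Y : PtsColl s) (hs : 1 ≤ s) :
    ∃ d, 0 < d ∧ d ≤ Real.pi / 4 ∧ 2 * d ≤ Y.y 0 - Y.y 1 ∧ 2 * d ≤ Y.y 1 - Y.y 2 := by
  have y01 : Y.y 1 < Y.y 0 := Y.lt 1 le_rfl (by omega)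
  have y12 : Y.y 2 < Y.y 1 := Y.lt 2 (by omega) (by omega)
  refine ⟨min (Real.pi / 4) (min ((Y.y 0 - Y.y 1) / 2) ((Y.y 1 - Y.y 2) / 2)),
    lt_min (by positivity) (lt_min (by linarith) (by linarith)), min_le_left _ _, ?_, ?_⟩
  · linarith [(min_le_right (Real.pi / 4) (min ((Y.y 0 - Y.y 1) / 2) ((Y.y 1 - Y.y 2) / 2))).trans
      (min_le_left _ _)]
  · linarith [(min_le_right (Real.pi / 4) (min ((Y.y 0 - Y.y 1) / 2) ((Y.y 1 - Y.y 2) / 2))).trans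
      (min_le_right _ _)]

lemma cos_sq_lt_one {θ : ℝ} (h0 : 0 < θ) (hπ : θ < Real.pi) : Real.cos θ ^ 2 < 1 := by
  have := Real.sin_sq_add_cos_sq θ
  have := pow_pos (Real.sin_pos_of_pos_of_lt_pi h0 hπ) 2
  linarith

lemma le_of_local_mass_le {n q l r : ℕ} (hn : 1 ≤ n) (hr : l + 2 ≤ r) {α K C₁ C₂ M κ : ℝ}
    (hK : 0 ≤ K) (hC₁ : 0 ≤ C₁) (hC₂ : 0 ≤ C₂) (hM : 0 ≤ M) (hκ : 0 ≤ κ)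
    (h : α * (1 / (640 * n)) ^ l - K / n ^ r * C₁ ≤
      160 * n * (2 * (1 / (640 * n)) * (α * (1 / (640 * n)) ^ l) + K / n ^ r * C₂ +
        κ ^ n * ((2 * n + 1) * (n ^ q * (M + K / n ^ r))))) :
    α / 640 ^ l / 2 ≤ K * (C₁ + 160 * C₂) * (1 / n) +
      480 * (M + K) * ((n : ℝ) ^ (q + l + 2) * κ ^ n) := by
  have hn' : (1 : ℝ) ≤ n := by exact_mod_cast hn
  have hn0 : (0 : ℝ) < n := by linarith
  have hpow : (n : ℝ) ^ (l + 2) ≤ n ^ r := pow_le_pow_right₀ hn' hr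
  set E := K / (n : ℝ) ^ r with hE
  have hEK : E ≤ K := div_le_self hK (one_le_pow₀ hn')
  have hE0 : 0 ≤ E := by positivity
  have hEn : (n : ℝ) ^ l * (n * E) ≤ K * (1 / n) := by
    rw [hE, mul_one_div, le_div_iff₀ hn0]
    have e : (n : ℝ) ^ l * (n * (K / n ^ r)) * n = K * (n ^ (l + 2) / n ^ r) := by ring
    rw [e]
    exact mul_le_of_le_one_right hK ((div_le_one (by positivity)).2 hpow)
  have hEn' : (n : ℝ) ^ l * E ≤ K * (1 / n) := by
    refine le_trans ?_ hEn
    gcongr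
    nlinarith
  have e1 : 160 * n * (2 * (1 / (640 * n)) * (α * (1 / (640 * n)) ^ l)) =
      α * (1 / (640 * (n : ℝ))) ^ l / 2 := by
    field_simp
    ring
  have e2 : (n : ℝ) ^ l * (α * (1 / (640 * n)) ^ l) = α / 640 ^ l := by
    rw [div_pow, mul_pow, one_pow]
    field_simp
  have h3 : 160 * n * (κ ^ n * ((2 * n + 1) * (n ^ q * (M + E)))) ≤
      160 * n * (κ ^ n * ((3 * n) * ((n : ℝ) ^ q * (M + K)))) := by
    gcongr
    linarith
  have h4 : α * (1 / (640 * (n : ℝ))) ^ l / 2 ≤ E * C₁ + 160 * n * (E * C₂) +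
      160 * n * (κ ^ n * ((3 * n) * (n ^ q * (M + K)))) := by
    linarith
  have h5 := mul_le_mul_of_nonneg_left h4 (by positivity : 0 ≤ (n : ℝ) ^ l)
  have h6 := mul_le_mul_of_nonneg_right hEn' hC₁
  have h7 := mul_le_mul_of_nonneg_right hEn (by positivity : 0 ≤ 160 * C₂)
  calc α / 640 ^ l / 2 = (n : ℝ) ^ l * (α * (1 / (640 * (n : ℝ))) ^ l / 2) := by rw [← e2]; ring
    _ ≤ _ := h5
    _ = (n : ℝ) ^ l * E * C₁ + (n : ℝ) ^ l * (n * E) * (160 * C₂) +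
        480 * (M + K) * ((n : ℝ) ^ (q + l + 2) * κ ^ n) := by ring
    _ ≤ _ := by linarith

lemma IsFlat.exists_far {q r s : ℕ} (hq : 3 ≤ q) (hrq : q ≤ r + 1) (hs : 1 ≤ s) {Y : PtsColl s}
    {f₀ : ℝ → ℝ} (hf₀ : IsFlat q s Y f₀) {a K : ℝ} (ha : 0 < a) (hK : 0 < K) (N : ℕ) :
    ∃ n, N ≤ n ∧ 1 ≤ n ∧ ∃ f, IsFlat q s Y f ∧
      (∀ x, |iteratedDeriv r f x - iteratedDeriv r f₀ x| ≤ a) ∧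
      ∀ T, IsTrigPoly n T → DeltaQ q s Y T → ∃ x, K ≤ n ^ r * |f x - T x| := by
  have hpi := Real.pi_pos
  obtain ⟨l, rfl⟩ : ∃ l, r = l + (q - 1) := ⟨r - (q - 1), by omega⟩
  obtain ⟨d, hd, hdπ, h01, h12⟩ := Y.exists_gap hs
  obtain ⟨C, hC0, hC⟩ := exists_isFlat_hump (q := q) (by omega) hs Y l hd hdπ h01 h12
  obtain ⟨ρ₀, hρ₀, hflat⟩ := hf₀.flat
  obtain ⟨ρ, hρ, hρ0, hρd⟩ : ∃ ρ, 0 < ρ ∧ ρ ≤ ρ₀ ∧ ρ ≤ d :=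
    ⟨min ρ₀ d, lt_min hρ₀ hd, min_le_left _ _, min_le_right _ _⟩
  have hρπ : ρ < Real.pi := by linarith
  obtain ⟨χ, hχ⟩ := exists_isCutoff (Y.y 1) hρ
  obtain ⟨M₀, hM₀⟩ := hf₀.perZero.periodic.exists_abs_le (hf₀.contDiff 0).continuous
  have hM₀' : 0 ≤ M₀ := (abs_nonneg _).trans (hM₀ 0)
  set M := M₀ + 16 ^ (l + (q - 1)) * a with hM
  set C₁ := ∫ x in (Y.y 1 - Real.pi)..(Y.y 1 + Real.pi), |iteratedDeriv q χ x| with hC₁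
  set C₂ := ∫ x in (Y.y 1 - Real.pi)..(Y.y 1 + Real.pi),
    |iteratedDeriv q (fun x => (x - Y.y 1) * χ x) x| with hC₂
  have hC₁0 : 0 ≤ C₁ := intervalIntegral.integral_nonneg (by linarith) fun x _ => abs_nonneg _
  have hC₂0 : 0 ≤ C₂ := intervalIntegral.integral_nonneg (by linarith) fun x _ => abs_nonneg _
  set α := a / (C + 1) with hα
  have hα0 : 0 < α := by positivity
  obtain ⟨n, hn, hn1, hlt⟩ := exists_nat_inv_add_pow_mul_lt (c := α / 640 ^ l / 2) (by positivity)
    (sq_nonneg (Real.cos (ρ / 4))) (cos_sq_lt_one (by linarith) (by linarith))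
    (K * (C₁ + 160 * C₂)) (480 * (M + K)) (q + l + 2) (max N ⌈1 / ρ⌉₊)
  have hn' : (1 : ℝ) ≤ n := by exact_mod_cast hn1
  have hn0 : (0 : ℝ) < n := by linarith
  have hnρ : 1 / ρ ≤ n := (Nat.le_ceil _).trans (by exact_mod_cast (le_max_right _ _).trans hn)
  refine ⟨n, (le_max_left _ _).trans hn, hn1, ?_⟩
  set b : ℝ := 1 / (640 * n) with hb
  have hb0 : 0 < b := by positivity
  have hbρ : 4 * b ≤ ρ := by
    rw [div_le_iff₀ hρ] at hnρ
    rw [hb, mul_one_div, div_le_iff₀ (by positivity)]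
    linarith
  have hbd : b ≤ d := by linarith
  set m := α * b ^ l with hm
  have hm0 : 0 ≤ m := by positivity
  obtain ⟨h, u, hh, hu, hhq, hhr⟩ := hC b m hb0 hbd hm0
  have hhr' : ∀ x, |iteratedDeriv (l + (q - 1)) h x| ≤ a := fun x => by
    refine (hhr x).trans ?_
    have e : m * (C * (1 / b) ^ l) = α * C := by
      rw [hm, one_div, inv_pow]
      field_simp
    rw [e, hα, div_mul_eq_mul_div, div_le_iff₀ (by positivity)]
    linarith
  have hadd : ∀ k x, iteratedDeriv k (fun x => f₀ x + h x) x =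
      iteratedDeriv k f₀ x + iteratedDeriv k h x := fun k x =>
    iteratedDeriv_fun_add (hf₀.contDiff k).contDiffAt (hh.contDiff k).contDiffAt
  have hf := hf₀.add hh
  refine ⟨fun x => f₀ x + h x, hf, fun x => ?_, fun T hT hTD => ?_⟩
  · rw [hadd, add_sub_cancel_left]
    exact hhr' x
  by_contra! hcon
  have hfM : ∀ x, |f₀ x + h x| ≤ M := fun x => by
    obtain ⟨p1, p2⟩ := hh.perZero.iteratedDeriv (l + (q - 1)) (hh.contDiff _)
    have := p1.abs_iterate_perInt_le hhr' (l + (q - 1)) x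
    rw [p2] at this
    exact (abs_add_le _ _).trans (add_le_add (hM₀ x) this)
  have hE : ∀ x, |f₀ x + h x - T x| ≤ K / n ^ (l + (q - 1)) := fun x => by
    rw [le_div_iff₀ (by positivity), mul_comm]
    exact (hcon x).le
  have hint : ∀ ψ : ℝ → ℝ, (∀ x, ρ ≤ |x - Y.y 1| → ψ x = 0) →
      ∫ x in (Y.y 1 - Real.pi)..(Y.y 1 + Real.pi),
        iteratedDeriv q (fun x => f₀ x + h x) x * ψ x =
      m * ∫ x in (Y.y 1 - Real.pi)..(Y.y 1 + Real.pi), deriv u x * ψ x := fun ψ hψ => by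
    rw [← intervalIntegral.integral_const_mul]
    congr 1
    funext x
    rcases lt_or_ge |x - Y.y 1| ρ with hx | hx
    · rw [hadd, hflat x (hx.trans_le hρ0), hhq, zero_add, mul_assoc]
    · rw [hψ x hx]; ring
  have key := hT.local_mass_le_of_approx (q := q) hn1 hρ hρπ hχ
    (fun x hx => hTD.local_sign (by omega) hs (fun k => hT.contDiff) (by linarith) (by linarith) hx)
    hf.contDiff hfM hE
  rw [hint χ hχ.eq_zero, hint (fun x => (x - Y.y 1) * χ x) fun x hx => by rw [hχ.eq_zero x hx, mul_zero],
    hu.integral_deriv_mul_cutoff hb0 hbd hdπ hρd hbρ hχ, mul_one] at key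
  have h2 := mul_le_mul_of_nonneg_left
    (hu.integral_deriv_mul_sub_mul_cutoff_le hb0 hbd hdπ hρd hbρ hχ) hm0
  refine absurd (le_of_local_mass_le (q := q) (M := M) hn1 (by omega) hK.le hC₁0 hC₂0
    (by positivity) (sq_nonneg (Real.cos (ρ / 4))) (key.trans ?_)) (not_le.2 hlt)
  refine mul_le_mul_of_nonneg_left ?_ (by positivity)
  linarith

open scoped BoundedContinuousFunction

lemma IsFlat.iteratedDeriv_perZero {q r s : ℕ} {Y : PtsColl s} {f : ℝ → ℝ} (hf : IsFlat q s Y f) :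
    PerZero (iteratedDeriv r f) ∧ perInt^[r] (iteratedDeriv r f) = f :=
  hf.perZero.iteratedDeriv r (hf.contDiff r)

lemma IsFlat.iterate_perInt_iteratedDeriv {q s : ℕ} {Y : PtsColl s} {f : ℝ → ℝ}
    (hf : IsFlat q s Y f) (j k : ℕ) :
    perInt^[j] (iteratedDeriv (j + k) f) = iteratedDeriv k f := by
  have e : iteratedDeriv (j + k) f = iteratedDeriv j (iteratedDeriv k f) := by
    simp only [iteratedDeriv_eq_iterate, Function.iterate_add_apply]
  have hd : ContDiff ℝ j (iteratedDeriv k f) := by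
    rw [iteratedDeriv_eq_iterate]
    exact ContDiff.iterate_deriv' j k (by exact_mod_cast hf.contDiff (j + k))
  rw [e]
  exact (hf.iteratedDeriv_perZero.1.iteratedDeriv j hd).2

lemma isFlat_zero (q s : ℕ) (Y : PtsColl s) : IsFlat q s Y (fun _ => 0) :=
  ⟨fun _ => contDiff_const, ⟨fun _ => rfl, fun _ _ => intervalIntegrable_const, by simp⟩,
    fun i _ _ x _ z _ _ => by simp, 1, one_pos, fun x _ => by simp⟩

/-- The bounded continuous functions which are `r`-th derivatives of flat functions. -/
def flatDerivs (q r s : ℕ) (Y : PtsColl s) : Set (ℝ →ᵇ ℝ) :=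
  {G | ∃ f, IsFlat q s Y f ∧ ⇑G = iteratedDeriv r f}

lemma IsFlat.exists_mem_flatDerivs {q s : ℕ} (r : ℕ) {Y : PtsColl s} {f : ℝ → ℝ}
    (hf : IsFlat q s Y f) : ∃ G ∈ flatDerivs q r s Y, ⇑G = iteratedDeriv r f := by
  have hc : Continuous (iteratedDeriv r f) := (hf.contDiff r).continuous_iteratedDeriv r le_rfl
  obtain ⟨C, hC⟩ := (hf.iteratedDeriv_perZero (r := r)).1.periodic.exists_abs_le hc
  exact ⟨BoundedContinuousFunction.ofNormedAddCommGroup _ hc C hC, ⟨f, hf, rfl⟩, rfl⟩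

section closure

variable {q r s : ℕ} {Y : PtsColl s} {G : ℝ →ᵇ ℝ}

lemma exists_isFlat_near (hG : G ∈ closure (flatDerivs q r s Y)) {ε : ℝ} (hε : 0 < ε) :
    ∃ f, IsFlat q s Y f ∧ ∀ x, |G x - iteratedDeriv r f x| ≤ ε := by
  obtain ⟨H, ⟨f, hf, hHf⟩, hd⟩ := Metric.mem_closure_iff.1 hG ε hε
  refine ⟨f, hf, fun x => ?_⟩
  rw [← hHf, ← Real.dist_eq]
  exact (BoundedContinuousFunction.dist_coe_le_dist x).trans hd.le

lemma perZero_of_mem_closure (hG : G ∈ closure (flatDerivs q r s Y)) : PerZero G := by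
  have hpi := Real.pi_pos
  refine ⟨fun x => eq_of_forall_dist_le fun ε hε => ?_,
    fun a b => G.continuous.intervalIntegrable a b, eq_of_forall_dist_le fun ε hε => ?_⟩
  · obtain ⟨f, hf, h⟩ := exists_isFlat_near hG (half_pos hε)
    have h1 := abs_le.1 (h x)
    have h2 := abs_le.1 (h (x + 2 * Real.pi))
    rw [hf.iteratedDeriv_perZero.1.periodic x] at h2
    rw [Real.dist_eq, abs_le]
    constructor <;> linarith
  · obtain ⟨f, hf, h⟩ := exists_isFlat_near hG (div_pos hε (by positivity : 0 < 2 * Real.pi))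
    have hp := (hf.iteratedDeriv_perZero (r := r)).1
    have := intervalIntegral.norm_integral_le_of_norm_le_const (a := 0) (b := 2 * Real.pi)
      (f := fun x => G x - iteratedDeriv r f x) fun x _ => h x
    rw [intervalIntegral.integral_sub (G.continuous.intervalIntegrable _ _) (hp.integrable _ _),
      hp.mean, sub_zero, sub_zero, abs_of_pos (by positivity : 0 < 2 * Real.pi),
      div_mul_cancel₀ _ (by positivity)] at this
    rwa [dist_zero_right]

lemma monotoneOn_iterate_perInt {j : ℕ} (hG : G ∈ closure (flatDerivs q (j + (q - 1)) s Y))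
    {i : ℕ} (h1 : 1 ≤ i) (h2 : i ≤ 2 * s) :
    MonotoneOn (fun x => (-1 : ℝ) ^ (i - 1) * perInt^[j] G x) (Set.Ioo (Y.y i) (Y.y (i - 1))) := by
  have hGz := perZero_of_mem_closure hG
  intro x hx z hz hxz
  refine le_of_forall_pos_le_add fun ε hε => ?_
  obtain ⟨f, hf, h⟩ := exists_isFlat_near hG (by positivity : 0 < ε / (2 * 16 ^ j))
  have hp := (hf.iteratedDeriv_perZero (r := j + (q - 1))).1
  have hd : ∀ x, |(-1 : ℝ) ^ (i - 1) * perInt^[j] G x -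
      (-1 : ℝ) ^ (i - 1) * iteratedDeriv (q - 1) f x| ≤ ε / 2 := fun x => by
    have := (hGz.sub hp).abs_iterate_perInt_le h j x
    rw [hGz.iterate_perInt_sub hp, hf.iterate_perInt_iteratedDeriv] at this
    rw [← mul_sub, abs_mul, abs_pow, abs_neg, abs_one, one_pow, one_mul]
    refine this.trans (le_of_eq ?_)
    field_simp
  have hm := hf.monotoneOn i h1 h2 hx hz hxz
  have e1 := abs_le.1 (hd x)
  have e2 := abs_le.1 (hd z)
  simp only at hm ⊢
  linarith

lemma deltaQ_of_mem_closure (hq : 3 ≤ q) (hrq : q ≤ r + 1)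
    (hG : G ∈ closure (flatDerivs q r s Y)) : DeltaQ q s Y (perInt^[r] G) := by
  obtain ⟨j, rfl⟩ : ∃ j, r = j + (q - 1) := ⟨r - (q - 1), by omega⟩
  have hGz := perZero_of_mem_closure hG
  have hc : Continuous (perInt^[j] G) := by
    rcases j with _ | j
    · exact G.continuous
    · rw [Function.iterate_succ_apply']
      exact (hGz.iterate_perInt j).continuous_perInt
  have hD : ∀ x, HasDerivAt (perInt^[j + 1] G) (perInt^[j] G x) x := fun x => by
    rw [Function.iterate_succ_apply']
    exact (hGz.iterate_perInt j).hasDerivAt_perInt hc.continuousAt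
  have hS : Continuous (perInt^[j + 1] G) :=
    continuous_iff_continuousAt.2 fun x => (hD x).continuousAt
  rw [show j + (q - 1) = (q - 2) + (j + 1) by omega, Function.iterate_add_apply]
  refine deltaQ_iterate_perInt hq (hGz.iterate_perInt _) fun i h1 h2 => ⟨hS.continuousOn, ?_⟩
  have hD' : ∀ x, HasDerivAt (fun x => (-1 : ℝ) ^ (i - 1) * perInt^[j + 1] G x)
      ((-1 : ℝ) ^ (i - 1) * perInt^[j] G x) x := fun x => (hD x).const_mul _
  refine MonotoneOn.convexOn_of_deriv (convex_Ioo _ _) (continuous_const.mul hS).continuousOn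
    (fun x _ => (hD' x).differentiableAt.differentiableWithinAt) ?_
  rw [interior_Ioo]
  exact (monotoneOn_iterate_perInt hG h1 h2).congr fun x _ => (hD' x).deriv.symm

end closure

/-- The set of `G` for which `G` integrated `r` times is badly approximated for some large
degree. -/
def badSet (q r s : ℕ) (Y : PtsColl s) (k : ℕ) : Set (closure (flatDerivs q r s Y)) :=
  {G | ∃ n, k ≤ n ∧ 1 ≤ n ∧ ∃ ε : ℝ, 0 < ε ∧ ∀ T, IsTrigPoly n T → DeltaQ q s Y T →
    ∃ x, k + ε ≤ n ^ r * |perInt^[r] G.1 x - T x|}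

lemma isOpen_badSet (q r s : ℕ) (Y : PtsColl s) (k : ℕ) : IsOpen (badSet q r s Y k) := by
  rw [Metric.isOpen_iff]
  rintro G ⟨n, hkn, hn, ε, hε, h⟩
  have hn' : (1 : ℝ) ≤ n := by exact_mod_cast hn
  have hn0 : (0 : ℝ) < n := by linarith
  refine ⟨ε / (2 * (n ^ r * 16 ^ r)), by positivity, fun H hH => ⟨n, hkn, hn, ε / 2, half_pos hε,
    fun T hT hTD => ?_⟩⟩
  obtain ⟨x, hx⟩ := h T hT hTD
  refine ⟨x, ?_⟩
  have hGz := perZero_of_mem_closure G.2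
  have hHz := perZero_of_mem_closure H.2
  have h1 : ∀ x, |G.1 x - H.1 x| ≤ ε / (2 * (n ^ r * 16 ^ r)) := fun x => by
    rw [← Real.dist_eq, dist_comm]
    exact (BoundedContinuousFunction.dist_coe_le_dist x).trans (Metric.mem_ball.1 hH).le
  have h2 := (hGz.sub hHz).abs_iterate_perInt_le h1 r x
  rw [hGz.iterate_perInt_sub hHz] at h2
  have h3 : (n : ℝ) ^ r * |perInt^[r] G.1 x - perInt^[r] H.1 x| ≤ ε / 2 := by
    refine (mul_le_mul_of_nonneg_left h2 (by positivity)).trans (le_of_eq ?_)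
    field_simp
  have h4 := mul_le_mul_of_nonneg_left
    (abs_sub_le (perInt^[r] G.1 x) (perInt^[r] H.1 x) (T x)) (by positivity : (0 : ℝ) ≤ n ^ r)
  linarith

lemma dense_badSet {q r s : ℕ} (hq : 3 ≤ q) (hrq : q ≤ r + 1) (hs : 1 ≤ s) (Y : PtsColl s)
    (k : ℕ) : Dense (badSet q r s Y k) := by
  rw [Metric.dense_iff]
  intro G η hη
  obtain ⟨f₀, hf₀, hG⟩ := exists_isFlat_near G.2 (by positivity : 0 < η / 4)
  obtain ⟨n, hkn, hn, f, hf, hff₀, hT⟩ := hf₀.exists_far (r := r) hq hrq hs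
    (by positivity : 0 < η / 4) (by positivity : (0 : ℝ) < k + 1) k
  obtain ⟨H, hH, hHf⟩ := hf.exists_mem_flatDerivs r
  refine ⟨⟨H, subset_closure hH⟩, ?_, n, hkn, hn, 1, one_pos, fun T h1 h2 => ?_⟩
  · rw [Metric.mem_ball, Subtype.dist_eq]
    refine lt_of_le_of_lt ((BoundedContinuousFunction.dist_le (by positivity : 0 ≤ η / 2)).2
      fun x => ?_) (half_lt_self hη)
    rw [hHf, Real.dist_eq]
    have := abs_sub_le (iteratedDeriv r f x) (iteratedDeriv r f₀ x) (G.1 x)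
    have h3 := hG x
    rw [abs_sub_comm] at h3
    linarith [hff₀ x]
  · simp only [hHf, hf.iteratedDeriv_perZero.2]
    exact hT T h1 h2

theorem no_jackson_of_ge {q r s : ℕ} (hq : 3 ≤ q) (hrq : q ≤ r + 1) (hs : 1 ≤ s) (Y : PtsColl s) :
    ∃ f : ℝ → ℝ, DeltaQ q s Y f ∧ SobolevW r f ∧
      ∀ M : ℝ, ∃ᶠ n : ℕ in Filter.atTop, M < (n : ℝ) ^ r * ErrCoQ q n s Y f := by
  have : CompleteSpace (closure (flatDerivs q r s Y)) := isClosed_closure.completeSpace_coe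
  obtain ⟨G₀, hG₀, hG₀z⟩ := (isFlat_zero q s Y).exists_mem_flatDerivs r
  have hdense := dense_iInter_of_isOpen_nat (isOpen_badSet q r s Y) (dense_badSet hq hrq hs Y)
  obtain ⟨G, hGball, hG⟩ := Metric.dense_iff.1 hdense ⟨G₀, subset_closure hG₀⟩ 2 two_pos
  have hGz := perZero_of_mem_closure G.2
  have hG2 : ∀ x, |G.1 x| ≤ 2 := fun x => by
    have h := (BoundedContinuousFunction.dist_coe_le_dist (f := G.1) (g := G₀) x).trans
      (Metric.mem_ball.1 hGball).le
    rw [hG₀z, Real.dist_eq] at h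
    rcases r with _ | r
    · omega
    · simpa using h
  have hD := deltaQ_of_mem_closure hq hrq G.2
  refine ⟨perInt^[r] G.1, hD, hGz.sobolevW hG2 (by omega), fun M => ?_⟩
  rw [Filter.frequently_atTop]
  intro N
  obtain ⟨n, hkn, hn, ε, hε, h⟩ := Set.mem_iInter.1 hG (max N ⌈M⌉₊)
  have hn0 : (0 : ℝ) < n := by exact_mod_cast hn
  refine ⟨n, (le_max_left _ _).trans hkn, ?_⟩
  have hM : M ≤ (max N ⌈M⌉₊ : ℕ) := (Nat.le_ceil M).trans (by exact_mod_cast le_max_right _ _)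
  have hle := le_errCoQ (c := ((max N ⌈M⌉₊ : ℕ) + ε) / n ^ r) hD.1 hD.2.1 fun T hT hTD => by
    obtain ⟨x, hx⟩ := h T hT hTD
    exact ⟨x, by rwa [div_le_iff₀ (by positivity), mul_comm]⟩
  rw [div_le_iff₀ (by positivity), mul_comm] at hle
  linarith

/-- **Theorem 1.1.** For each `q ≥ 3`, `r ∈ ℕ`, `s ∈ ℕ` and any `Y_s ∈ 𝕐_s`, there exists a
function `f ∈ Δ^(q)(Y_s) ∩ W^r` such that `limsup_{n→∞} n^r E_n^(q)(f, Y_s) = ∞`. -/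
theorem no_jackson_co_q_monotone (q r s : ℕ) (hq : 3 ≤ q) (hr : 1 ≤ r) (hs : 1 ≤ s)
    (Y : PtsColl s) :
    ∃ f : ℝ → ℝ, DeltaQ q s Y f ∧ SobolevW r f ∧
      ∀ M : ℝ, ∃ᶠ n : ℕ in Filter.atTop, M < (n : ℝ) ^ r * ErrCoQ q n s Y f := by
  rcases Nat.lt_or_ge (r + 1) q with h | h
  · exact no_jackson_of_le hq hr h hs Y
  · exact no_jackson_of_ge hq h hs Y
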